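/- arXiv:math/0511622 — 4 statements merged into one kernel-verified Lean document; each statement's English description precedes it below -/
import Mathlib

section
/- Let n and m be positive integers, let λ ∈ ℂ be a primitive m-th root of unity, and let f be a holomorphic map from an open ball Δⁿ ⊆ ℂⁿ centered at the origin into ℂⁿ with f(0) = 0 and Fréchet derivative f'(0) = λ·I (equivalently, f(z) = λz + o(‖z‖) as z → 0). Then the m-th iterate of f satisfies f^[m](z) = z + o(‖z‖^m) as z → 0, i.e., f^[m](z) − z = o(‖z‖^m). -/
open Asymptotics Filter

section Holomorphic

open Topology Metric

variable {E F : Type*} [NormedAddCommGroup E] [NormedSpace ℂ E]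
  [NormedAddCommGroup F] [NormedSpace ℂ F]

/-- A map holomorphic near `0` which vanishes to order more than `n` along every complex line
through `0` is `O(‖z‖ ^ (n + 1))`, uniformly in the direction. -/
theorem isBigO_norm_pow_succ_of_isLittleO_lines {h : E → F} {n : ℕ}
    (hd : ∀ᶠ z in 𝓝 0, DifferentiableAt ℂ h z) (h0 : h 0 = 0)
    (ho : ∀ v : E, (fun t : ℂ => h (t • v)) =o[𝓝 0] fun t => t ^ n) :
    h =O[𝓝 0] fun z => ‖z‖ ^ (n + 1) := by
  have hbd : ∀ᶠ z in 𝓝 0, ‖h z‖ < 1 := by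
    have hc : ContinuousAt (fun z => ‖h z‖) 0 := hd.self_of_nhds.continuousAt.norm
    exact hc.eventually_lt continuousAt_const (by simp [h0])
  obtain ⟨r, hr, hball⟩ := Metric.eventually_nhds_iff_ball.1 (hd.and hbd)
  refine IsBigO.of_bound ((2 / r) ^ (n + 1)) ?_
  filter_upwards [ball_mem_nhds (0 : E) (half_pos hr)] with z hz
  rw [mem_ball_zero_iff] at hz
  rcases eq_or_ne z 0 with rfl | hz0
  · simp [h0]
  have hzpos : 0 < ‖z‖ := norm_pos_iff.2 hz0
  set t : ℝ := 2 * ‖z‖ / r with ht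
  have htpos : 0 < t := by positivity
  have htC : (t : ℂ) ≠ 0 := by exact_mod_cast htpos.ne'
  set v : E := (t : ℂ)⁻¹ • z with hv
  have hvn : ‖v‖ = r / 2 := by
    rw [hv, norm_smul, norm_inv, Complex.norm_of_nonneg htpos.le, ht]
    field_simp
  have hmem : ∀ s ∈ ball (0 : ℂ) 1, s • v ∈ ball (0 : E) r := fun s hs => by
    rw [mem_ball_zero_iff] at hs ⊢
    rw [norm_smul, hvn]
    nlinarith
  have key := Complex.dist_le_mul_div_pow_of_mapsTo_ball_of_isLittleO
    (f := fun s : ℂ => h (s • v)) (c := 0) (z := t) (R₁ := 1) (R₂ := 1) (n := n)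
    (fun s hs => ((hball _ (hmem s hs)).1.comp s
      (differentiableAt_id.smul_const v)).differentiableWithinAt)
    (fun s hs => by simpa [h0] using (hball _ (hmem s hs)).2.le)
    (by simpa [h0] using (ho v).norm_right)
    (by
      rw [mem_ball_zero_iff, Complex.norm_of_nonneg htpos.le, ht, div_lt_one hr]
      linarith)
  have hz' : (t : ℂ) • v = z := by rw [hv, smul_inv_smul₀ htC]
  simp only [hz', zero_smul, h0, dist_zero_right, Complex.norm_of_nonneg htpos.le, div_one,
    one_mul] at key
  rw [norm_pow, norm_norm, ← mul_pow]
  exact key.trans_eq (by rw [ht]; ring)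

/-- A map holomorphic near `0` with zero value and zero derivative at `0` is `O(‖z‖ ^ 2)`. -/
theorem isBigO_norm_sq_of_hasFDerivAt_zero {h : E → F}
    (hd : ∀ᶠ z in 𝓝 0, DifferentiableAt ℂ h z) (h0 : h 0 = 0)
    (h' : HasFDerivAt h (0 : E →L[ℂ] F) 0) : h =O[𝓝 0] fun z => ‖z‖ ^ 2 := by
  refine isBigO_norm_pow_succ_of_isLittleO_lines hd h0 fun v => ?_
  have ho : h =o[𝓝 0] fun z => z := by
    simpa [h0, hasFDerivAt_iff_isLittleO_nhds_zero] using h'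
  have hline : Tendsto (fun t : ℂ => t • v) (𝓝 0) (𝓝 0) :=
    Continuous.tendsto' (by fun_prop) _ _ (by simp)
  refine (ho.comp_tendsto hline).trans_isBigO
    (IsBigO.of_bound ‖v‖ (Eventually.of_forall fun t => ?_))
  simp [norm_smul, mul_comm]

/-- A map holomorphic near `0` that is `O(‖z‖ ^ n)` has a leading coefficient of degree `n` along
every complex line through `0`. -/
theorem exists_tendsto_inv_pow_smul_of_isBigO [CompleteSpace F] {h : E → F} {n : ℕ}
    (hd : ∀ᶠ z in 𝓝 0, DifferentiableAt ℂ h z) (hO : h =O[𝓝 0] fun z => ‖z‖ ^ n) (v : E) :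
    ∃ L, Tendsto (fun t : ℂ => (t ^ n)⁻¹ • h (t • v)) (𝓝[≠] 0) (𝓝 L) := by
  have hline : Tendsto (fun t : ℂ => t • v) (𝓝 0) (𝓝 0) :=
    Continuous.tendsto' (by fun_prop) _ _ (by simp)
  refine ⟨_, Complex.tendsto_limUnder_of_differentiable_on_punctured_nhds_of_bounded_under ?_ ?_⟩
  · filter_upwards [nhdsWithin_le_nhds (hline.eventually hd), self_mem_nhdsWithin] with t ht ht0
    exact ((differentiableAt_id.pow n).inv (pow_ne_zero n ht0)).smul
      (ht.comp t (differentiableAt_id.smul_const v))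
  · obtain ⟨C, hC⟩ := (hO.comp_tendsto hline).bound
    set q := ((0 : ℂ) ^ n)⁻¹ • h ((0 : ℂ) • v)
    refine ⟨C * ‖v‖ ^ n + ‖q‖, eventually_map.2 ?_⟩
    filter_upwards [nhdsWithin_le_nhds hC, self_mem_nhdsWithin] with t ht ht0
    have htn : 0 < ‖t‖ ^ n := pow_pos (norm_pos_iff.2 ht0) n
    refine norm_sub_le_of_le ?_ le_rfl
    simp only [Function.comp_apply, norm_pow, norm_norm] at ht
    rw [norm_smul, mul_pow] at ht
    rw [norm_smul, norm_inv, norm_pow, inv_mul_le_iff₀ htn]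
    linarith

/-- A map holomorphic near `0` that is `O(‖z‖ ^ (n + 1))` is Lipschitz on small balls of
radius `ρ` with constant `O(ρ ^ n)`. -/
theorem isBigO_sub_of_isBigO_norm_pow_succ {h : E → F} {n : ℕ}
    (hd : ∀ᶠ z in 𝓝 0, DifferentiableAt ℂ h z) (hO : h =O[𝓝 0] fun z => ‖z‖ ^ (n + 1))
    {a b : E → E} (ha : a =O[𝓝 0] fun z => z) (hb : b =O[𝓝 0] fun z => z) :
    (fun z => h (a z) - h (b z)) =O[𝓝 0] fun z => ‖z‖ ^ n * ‖a z - b z‖ := by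
  obtain ⟨A, hA⟩ := ha.bound
  obtain ⟨B, hB⟩ := hb.bound
  obtain ⟨C, hCpos, hC⟩ := hO.exists_pos
  obtain ⟨r, hr, hball⟩ := Metric.eventually_nhds_iff_ball.1 (hd.and hC.bound)
  set K : ℝ := max (max A B) 1
  have hK : 0 < K := lt_max_of_lt_right one_pos
  refine IsBigO.of_bound (2 * C * (2 * K) ^ (n + 1) / K) ?_
  filter_upwards [hA, hB, ball_mem_nhds (0 : E) (show 0 < r / (2 * K) by positivity)]
    with z hAz hBz hz
  rw [mem_ball_zero_iff, lt_div_iff₀ (by positivity)] at hz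
  rcases eq_or_ne z 0 with rfl | hz0
  · have ha0 : a 0 = 0 := by simpa using hAz
    have hb0 : b 0 = 0 := by simpa using hBz
    simp [ha0, hb0]
  have hzpos : 0 < ‖z‖ := norm_pos_iff.2 hz0
  set ρ : ℝ := K * ‖z‖ with hρ
  have hρpos : 0 < ρ := by positivity
  have haz : a z ∈ closedBall (0 : E) ρ := by
    rw [mem_closedBall_zero_iff]
    exact hAz.trans (by rw [hρ]; gcongr; exact (le_max_left A B).trans (le_max_left _ _))
  have hbz : b z ∈ closedBall (0 : E) ρ := by
    rw [mem_closedBall_zero_iff]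
    exact hBz.trans (by rw [hρ]; gcongr; exact (le_max_right A B).trans (le_max_left _ _))
  have hlt : ∀ x ∈ closedBall (0 : E) ρ, ∀ y ∈ ball x ρ, ‖y‖ < 2 * ρ := fun x hx y hy => by
    rw [mem_closedBall_zero_iff] at hx
    rw [mem_ball_iff_norm] at hy
    linarith [norm_le_norm_add_norm_sub' y x]
  have hin : ∀ y : E, ‖y‖ < 2 * ρ → y ∈ ball (0 : E) r := fun y hy => by
    rw [mem_ball_zero_iff]
    linarith
  have hbound : ∀ y : E, ‖y‖ < 2 * ρ → ‖h y‖ ≤ C * (2 * ρ) ^ (n + 1) := fun y hy => by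
    have := (hball y (hin y hy)).2
    rw [norm_pow, norm_norm] at this
    exact this.trans (by gcongr)
  have hderiv : ∀ x ∈ closedBall (0 : E) ρ,
      ‖fderiv ℂ h x‖ ≤ 2 * (C * (2 * ρ) ^ (n + 1)) / ρ := fun x hx => by
    refine Complex.norm_fderiv_le_div_of_mapsTo_ball
      (fun y hy => (hball y (hin y (hlt x hx y hy))).1.differentiableWithinAt)
      (fun y hy => ?_) hρpos
    rw [mem_closedBall_iff_norm]
    have h1 := hbound y (hlt x hx y hy)
    have h2 := hbound x (hlt x hx x (mem_ball_self hρpos))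
    linarith [norm_sub_le (h y) (h x)]
  have key := Convex.norm_image_sub_le_of_norm_fderiv_le (𝕜 := ℂ)
    (fun x hx => (hball x (hin x (hlt x hx x (mem_ball_self hρpos)))).1) hderiv
    (convex_closedBall (0 : E) ρ) hbz haz
  refine key.trans_eq ?_
  rw [norm_mul, norm_pow, norm_norm, norm_norm, hρ]
  field_simp
  ring

/-- A map holomorphic near `0` that satisfies `h (μ z) = μ h z` up to order `n + 1` has no
homogeneous part of degree `n` when `μ ^ n ≠ μ`. -/
theorem isBigO_norm_pow_succ_of_isBigO_smul_sub_smul [CompleteSpace F] {h : E → F} {n : ℕ} {μ : ℂ}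
    (hd : ∀ᶠ z in 𝓝 0, DifferentiableAt ℂ h z) (h0 : h 0 = 0)
    (hO : h =O[𝓝 0] fun z => ‖z‖ ^ n) (hμ0 : μ ≠ 0) (hμ : μ ^ n ≠ μ)
    (hcomm : (fun z => h (μ • z) - μ • h z) =O[𝓝 0] fun z => ‖z‖ ^ (n + 1)) :
    h =O[𝓝 0] fun z => ‖z‖ ^ (n + 1) := by
  refine isBigO_norm_pow_succ_of_isLittleO_lines hd h0 fun v => ?_
  obtain ⟨L, hL⟩ := exists_tendsto_inv_pow_smul_of_isBigO hd hO v
  have hline : Tendsto (fun t : ℂ => t • v) (𝓝 0) (𝓝 0) :=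
    Continuous.tendsto' (by fun_prop) _ _ (by simp)
  have hmul : Tendsto (fun t : ℂ => μ * t) (𝓝[≠] 0) (𝓝[≠] 0) := by
    refine tendsto_nhdsWithin_iff.2 ⟨?_, ?_⟩
    · exact (Continuous.tendsto' (by fun_prop) _ _ (by simp)).mono_left nhdsWithin_le_nhds
    · filter_upwards [self_mem_nhdsWithin] with t ht using mul_ne_zero hμ0 ht
  have hlim : Tendsto (fun t : ℂ => (t ^ n)⁻¹ • (h (μ • t • v) - μ • h (t • v))) (𝓝[≠] 0)
      (𝓝 (μ ^ n • L - μ • L)) := by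
    refine (((hL.comp hmul).const_smul (μ ^ n)).sub (hL.const_smul μ)).congr fun t => ?_
    simp only [Function.comp_apply]
    rw [smul_sub, smul_smul, mul_pow, mul_inv, mul_inv_cancel_left₀ (pow_ne_zero n hμ0), mul_smul,
      smul_comm μ (t ^ n)⁻¹]
  have hzero : Tendsto (fun t : ℂ => (t ^ n)⁻¹ • (h (μ • t • v) - μ • h (t • v))) (𝓝[≠] 0)
      (𝓝 0) := by
    refine IsLittleO.tendsto_inv_smul_nhds_zero (IsLittleO.mono ?_ nhdsWithin_le_nhds)
    have hpow : (fun t : ℂ => ‖t • v‖ ^ (n + 1)) =O[𝓝 0] fun t => t ^ (n + 1) :=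
      IsBigO.of_bound (‖v‖ ^ (n + 1)) (Eventually.of_forall fun t => by
        simp [norm_smul, mul_pow, mul_comm])
    exact ((hcomm.comp_tendsto hline).trans hpow).trans_isLittleO
      (isLittleO_pow_pow n.lt_succ_self)
  have hL0 : L = 0 := by
    have heq := tendsto_nhds_unique hlim hzero
    rw [← sub_smul] at heq
    exact (smul_eq_zero.1 heq).resolve_left (sub_ne_zero.2 hμ)
  subst hL0
  have hpunct : (fun t : ℂ => h (t • v)) =o[𝓝[≠] 0] fun t => t ^ n := by
    have := (isLittleO_one_iff ℂ).2 hL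
    refine ((isBigO_refl (fun t : ℂ => t ^ n) _).smul_isLittleO this).congr' ?_ ?_
    · filter_upwards [self_mem_nhdsWithin] with t ht
      exact smul_inv_smul₀ (pow_ne_zero n ht) _
    · simp
  rw [← nhdsNE_sup_pure, isLittleO_sup]
  refine ⟨hpunct, ?_⟩
  rw [isLittleO_pure]
  simp [h0]

/-- Iterates of a map holomorphic near a fixed point are holomorphic near it. -/
theorem eventually_differentiableAt_iterate {f : E → E}
    (hd : ∀ᶠ z in 𝓝 0, DifferentiableAt ℂ f z) (h0 : f 0 = 0) (k : ℕ) :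
    ∀ᶠ z in 𝓝 0, DifferentiableAt ℂ f^[k] z := by
  have hf : Tendsto f (𝓝 0) (𝓝 0) := by
    simpa [h0] using hd.self_of_nhds.continuousAt.tendsto
  induction k with
  | zero => exact Eventually.of_forall fun z => differentiableAt_id
  | succ k ih =>
    filter_upwards [hd, hf.eventually ih] with z hz hk
    exact hk.comp z hz

end Holomorphic

/-- **Iteration formula.** If `f` is holomorphic on a ball `Δⁿ ⊆ ℂⁿ` centered at the origin,
with `f 0 = 0` and `f'(0) = λ·I` where `λ` is a primitive `m`-th root of unity, then
`f^[m] z = z + o(‖z‖^m)` as `z → 0`. -/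
theorem iteration_formula (n m : ℕ) (hn : 0 < n) (hm : 0 < m) (lam : ℂ)
    (hroot : lam ^ m = 1) (hprim : ∀ j : ℕ, 0 < j → j < m → lam ^ j ≠ 1)
    (R : ℝ) (hR : 0 < R)
    (f : EuclideanSpace ℂ (Fin n) → EuclideanSpace ℂ (Fin n))
    (hf : DifferentiableOn ℂ f (Metric.ball 0 R))
    (hf0 : f 0 = 0)
    (hdf : fderiv ℂ f 0 = lam • ContinuousLinearMap.id ℂ (EuclideanSpace ℂ (Fin n))) :
    (fun z => f^[m] z - z) =o[nhds (0 : EuclideanSpace ℂ (Fin n))] (fun z => ‖z‖ ^ m) := by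
  have hlam0 : lam ≠ 0 := by
    rintro rfl
    simp [hm.ne'] at hroot
  have hfd : ∀ᶠ z in nhds 0, DifferentiableAt ℂ f z := by
    filter_upwards [Metric.ball_mem_nhds 0 hR] with z hz
    exact hf.differentiableAt (Metric.isOpen_ball.mem_nhds hz)
  have hf' : HasFDerivAt f (lam • ContinuousLinearMap.id ℂ (EuclideanSpace ℂ (Fin n))) 0 :=
    hdf ▸ hfd.self_of_nhds.hasFDerivAt
  have hg' := hf'.iterate hf0 m
  have hg0 : f^[m] 0 = 0 := Function.iterate_fixed hf0 m
  have hgd := eventually_differentiableAt_iterate hfd hf0 m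
  have hed : ∀ᶠ z in nhds 0, DifferentiableAt ℂ (fun z => f z - lam • z) z :=
    hfd.mono fun z hz => hz.sub (differentiableAt_id.const_smul lam)
  have hhd : ∀ᶠ z in nhds 0, DifferentiableAt ℂ (fun z => f^[m] z - z) z :=
    hgd.mono fun z hz => hz.sub differentiableAt_id
  have he : (fun z => f z - lam • z) =O[nhds 0] fun z => ‖z‖ ^ 2 := by
    refine isBigO_norm_sq_of_hasFDerivAt_zero hed (by simp [hf0]) ?_
    rw [← sub_self (lam • ContinuousLinearMap.id ℂ (EuclideanSpace ℂ (Fin n)))]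
    exact hf'.sub ((hasFDerivAt_id 0).const_smul lam)
  have hh : (fun z => f^[m] z - z) =O[nhds 0] fun z => ‖z‖ ^ 2 := by
    refine isBigO_norm_sq_of_hasFDerivAt_zero hhd (by simp [hg0]) ?_
    have hpow : (lam • ContinuousLinearMap.id ℂ (EuclideanSpace ℂ (Fin n))) ^ m =
        ContinuousLinearMap.id ℂ (EuclideanSpace ℂ (Fin n)) := by
      change (lam • (1 : EuclideanSpace ℂ (Fin n) →L[ℂ] EuclideanSpace ℂ (Fin n))) ^ m = 1
      rw [smul_pow, hroot, one_pow, one_smul]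
    rw [hpow] at hg'
    rw [← sub_self (ContinuousLinearMap.id ℂ (EuclideanSpace ℂ (Fin n)))]
    exact hg'.sub (hasFDerivAt_id 0)
  have hfO : f =O[nhds 0] fun z => z := by simpa [hf0] using hf'.isBigO_sub
  have hgO : f^[m] =O[nhds 0] fun z => z := by simpa [hg0] using hg'.isBigO_sub
  have hlamO : (fun z : EuclideanSpace ℂ (Fin n) => lam • z) =O[nhds 0] fun z => z :=
    (isBigO_refl _ _).const_smul_left lam
  have order : ∀ j : ℕ, 1 ≤ j → j ≤ m →
      (fun z => f^[m] z - z) =O[nhds 0] fun z => ‖z‖ ^ (j + 1) := by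
    intro j hj
    induction j, hj using Nat.le_induction with
    | base => exact fun _ => hh
    | succ j hj ih =>
      intro hjm
      have hO := ih (by omega)
      refine isBigO_norm_pow_succ_of_isBigO_smul_sub_smul hhd (by simp [hg0]) hO hlam0 ?_ ?_
      · intro hpow
        rw [pow_succ] at hpow
        exact hprim j hj (by omega) (mul_eq_right₀ hlam0 |>.1 hpow)
      · have hE := isBigO_sub_of_isBigO_norm_pow_succ hed he hgO
          (isBigO_refl (fun z : EuclideanSpace ℂ (Fin n) => z) _)
        have hH := isBigO_sub_of_isBigO_norm_pow_succ hhd hO hfO hlamO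
        have hE' := hE.trans ((isBigO_refl _ _).mul hO.norm_left)
        have hH' := hH.trans ((isBigO_refl _ _).mul he.norm_left)
        refine ((hE'.congr_right fun z => ?_).sub (hH'.congr_right fun z => ?_)).congr_left
          fun z => ?_
        · ring
        · ring
        · have hcomm : f^[m] (f z) = f (f^[m] z) :=
            (Function.iterate_succ_apply f m z).symm.trans (Function.iterate_succ_apply' f m z)
          simp only [hcomm, smul_sub]
          abel
  refine (order m hm le_rfl).trans_isLittleO ?_
  exact (isLittleO_pow_pow m.lt_succ_self).comp_tendsto
    (Continuous.tendsto' continuous_norm _ _ norm_zero)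
end

section
/- Let F : Δⁿ → ℂⁿ be a holomorphic map on an open ball Δⁿ ⊆ ℂⁿ centered at the origin with F(0) = 0, and suppose the Fréchet derivative F'(0) = iω·I for some nonzero real number ω. Set T = 2π/|ω|. Then there exists ε > 0 with the closed ball B̄(0,ε) ⊆ Δⁿ such that every differentiable curve γ : [0, T] → Δⁿ satisfying γ'(t) = F(γ(t)) for all t ∈ [0, T] and ‖γ(0)‖ < ε satisfies γ(T) = γ(0); that is, every solution of the system ż = F(z) starting sufficiently close to the origin returns to its initial point after time 2π/|ω|. -/
open Asymptotics Filter

open Metric in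
/-- A holomorphic map that vanishes to second order at the origin is Lipschitz near the origin,
with an arbitrarily small constant. -/
theorem exists_ball_lipschitz_of_fderiv_eq_zero {E F : Type*}
    [NormedAddCommGroup E] [NormedSpace ℂ E] [NormedAddCommGroup F] [NormedSpace ℂ F]
    {h : E → F} {R : ℝ} (hR : 0 < R) (hd : DifferentiableOn ℂ h (ball 0 R)) (h0 : h 0 = 0)
    (hd0 : fderiv ℂ h 0 = 0) {η : ℝ} (hη : 0 < η) :
    ∃ ρ > 0, ρ < R ∧ ∀ x ∈ ball (0 : E) ρ, ∀ y ∈ ball (0 : E) ρ,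
      ‖h y - h x‖ ≤ η * ‖y - x‖ := by
  have hfd : HasFDerivAt h (0 : E →L[ℂ] F) 0 :=
    hd0 ▸ (hd.differentiableAt (ball_mem_nhds 0 hR)).hasFDerivAt
  have hlo := hfd.isLittleO.def (show 0 < η / 4 by positivity)
  obtain ⟨r, hr, hball⟩ := Metric.eventually_nhds_iff_ball.1 hlo
  simp only [h0, sub_zero, zero_apply] at hball
  have hm : 0 < min r R := lt_min hr hR
  refine ⟨min r R / 2, by positivity, by linarith [min_le_right r R], fun x hx y hy => ?_⟩
  have hsub : ∀ z ∈ ball (0 : E) (min r R / 2), ball z (min r R / 2) ⊆ ball 0 (min r R) := by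
    intro z hz
    refine ball_subset_ball' ?_
    linarith [mem_ball.1 hz]
  have hbd : ∀ z ∈ ball (0 : E) (min r R), ‖h z‖ ≤ η / 4 * min r R := by
    intro z hz
    refine (hball z (ball_subset_ball (min_le_left _ _) hz)).trans ?_
    have := mem_ball_zero_iff.1 hz
    gcongr
  have hdm := hd.mono (ball_subset_ball (min_le_right r R))
  have hin : ball (0 : E) (min r R / 2) ⊆ ball 0 (min r R) := ball_subset_ball (by linarith)
  refine (convex_ball (0 : E) (min r R / 2)).norm_image_sub_le_of_norm_fderiv_le
    (𝕜 := ℂ) (fun z hz => hdm.differentiableAt (isOpen_ball.mem_nhds (hin hz)))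
    (fun z hz => ?_) hx hy
  have := Complex.norm_fderiv_le_div_of_mapsTo_ball (R₂ := η * (min r R / 2))
    (hdm.mono (hsub z hz)) (fun u hu => ?_) (by positivity)
  · rwa [mul_div_assoc, div_self (by positivity), mul_one] at this
  · rw [mem_closedBall, dist_eq_norm]
    refine (norm_sub_le _ _).trans ?_
    linarith [hbd u (hsub z hz hu), hbd z (hin hz)]

open Metric in
/-- A bounded holomorphic function on the disc of radius `2` with a double zero at the origin is
`s ^ 2` times a holomorphic function satisfying the corresponding bound. -/
theorem exists_eq_sq_smul_of_deriv_eq_zero {E : Type*} [NormedAddCommGroup E] [NormedSpace ℂ E]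
    [CompleteSpace E] {f : ℂ → E} {M : ℝ} (hd : DifferentiableOn ℂ f (ball 0 2))
    (h0 : f 0 = 0) (hd0 : deriv f 0 = 0) (hM : ∀ s ∈ ball (0 : ℂ) 2, ‖f s‖ ≤ M) :
    ∃ k : ℂ → E, DifferentiableOn ℂ k (ball 0 2) ∧ (∀ s ∈ ball (0 : ℂ) 2, ‖k s‖ ≤ M / 4) ∧
      ∀ s, f s = s ^ 2 • k s := by
  have hnhds : ball (0 : ℂ) 2 ∈ nhds (0 : ℂ) := ball_mem_nhds 0 two_pos
  have hd1 : DifferentiableOn ℂ (dslope f 0) (ball 0 2) :=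
    (Complex.differentiableOn_dslope hnhds).2 hd
  have h1 : dslope f 0 0 = 0 := by rw [dslope_same, hd0]
  have hb1 : ∀ s ∈ ball (0 : ℂ) 2, ‖dslope f 0 s‖ ≤ M / 2 := fun s hs =>
    Complex.norm_dslope_le_div_of_mapsTo_ball (R₂ := M) hd (fun u hu => by simpa [h0] using hM u hu) hs
  refine ⟨dslope (dslope f 0) 0, (Complex.differentiableOn_dslope hnhds).2 hd1,
    fun s hs => ?_, fun s => ?_⟩
  · have := Complex.norm_dslope_le_div_of_mapsTo_ball (R₂ := M / 2) hd1
      (fun u hu => by simpa [hd0] using hb1 u hu) hs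
    linarith
  · have e1 := sub_smul_dslope f 0 s
    have e2 := sub_smul_dslope (dslope f 0) 0 s
    rw [sub_zero, h0, sub_zero] at e1
    rw [sub_zero, h1, sub_zero] at e2
    rw [sq, mul_smul, e2, e1]

open Metric in
/-- One step of the Picard iteration on the disc of radius `2` for the equation
`c * s ^ 2 * w' = h (s * w)` with `w 1 = a`. -/
theorem exists_picard_step {E : Type*} [NormedAddCommGroup E] [NormedSpace ℂ E]
    [CompleteSpace E] {h : E → E} {ρ η : ℝ} {c : ℂ} (hc : c ≠ 0) (hρ : 0 < ρ) (hη : 0 < η)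
    (hηc : 3 * η < ‖c‖)
    (hd : DifferentiableOn ℂ h (ball 0 ρ)) (h0 : h 0 = 0) (hd0 : fderiv ℂ h 0 = 0)
    (hbd : ∀ x ∈ ball (0 : E) ρ, ‖h x‖ ≤ η * ρ) {a : E} (ha : ‖a‖ < ρ / 4)
    {w : ℂ → E} (hw : DifferentiableOn ℂ w (ball 0 2)) (hwb : ∀ s ∈ ball (0 : ℂ) 2, ‖w s‖ < ρ / 2) :
    ∃ v : ℂ → E, v 1 = a ∧ (∀ s ∈ ball (0 : ℂ) 2, ‖v s‖ < ρ / 2) ∧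
      ∃ v' : ℂ → E, (∀ s ∈ ball (0 : ℂ) 2, HasDerivAt v (v' s) s) ∧
        ∀ s, h (s • w s) = (c * s ^ 2) • v' s := by
  have hmaps : ∀ s ∈ ball (0 : ℂ) 2, s • w s ∈ ball (0 : E) ρ := by
    intro s hs
    rw [mem_ball_zero_iff, norm_smul]
    nlinarith [hwb s hs, mem_ball_zero_iff.1 hs, norm_nonneg s, norm_nonneg (w s)]
  have hsw : DifferentiableOn ℂ (fun s => s • w s) (ball 0 2) := differentiableOn_id.smul hw
  have hfd : HasFDerivAt h (0 : E →L[ℂ] E) ((0 : ℂ) • w 0) := by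
    rw [zero_smul, ← hd0]
    exact (hd.differentiableAt (ball_mem_nhds 0 hρ)).hasFDerivAt
  have hder : deriv (fun s => h (s • w s)) 0 = 0 := by
    have h2 := (hsw.differentiableAt (ball_mem_nhds 0 two_pos)).hasDerivAt
    exact (hfd.comp_hasDerivAt (0 : ℂ) h2).deriv
  obtain ⟨k, hkd, hkb, hk⟩ := exists_eq_sq_smul_of_deriv_eq_zero (f := fun s => h (s • w s))
    (hd.comp hsw hmaps) (by simp [h0]) hder (fun s hs => hbd _ (hmaps s hs))
  obtain ⟨v, hv1, hv⟩ := ((hkd.const_smul c⁻¹).isExactOn_ball).with_val_at 1 a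
  have hone : (1 : ℂ) ∈ ball (0 : ℂ) 2 := by simp
  refine ⟨v, hv1, fun s hs => ?_, _, hv, fun s => ?_⟩
  · have hcn : 0 < ‖c‖ := norm_pos_iff.2 hc
    have hle := (convex_ball (0 : ℂ) 2).norm_image_sub_le_of_norm_hasDerivWithin_le
      (C := ‖c‖⁻¹ * (η * ρ / 4)) (fun x hx => (hv x hx).hasDerivWithinAt)
      (fun x hx => by
        simp only [Pi.smul_apply, norm_smul, norm_inv]
        gcongr
        exact hkb x hx) hone hs
    have hs1 : ‖s - 1‖ ≤ 3 := by
      refine (norm_sub_le _ _).trans ?_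
      rw [norm_one]
      linarith [mem_ball_zero_iff.1 hs]
    have hC : ‖c‖⁻¹ * (η * ρ / 4) * ‖s - 1‖ ≤ ρ / 4 := by
      calc ‖c‖⁻¹ * (η * ρ / 4) * ‖s - 1‖ ≤ ‖c‖⁻¹ * (η * ρ / 4) * 3 := by gcongr
        _ = ‖c‖⁻¹ * (3 * η) * (ρ / 4) := by ring
        _ ≤ ‖c‖⁻¹ * ‖c‖ * (ρ / 4) := by gcongr
        _ = ρ / 4 := by rw [inv_mul_cancel₀ hcn.ne', one_mul]
    rw [hv1] at hle
    calc ‖v s‖ = ‖(v s - a) + a‖ := by rw [sub_add_cancel]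
      _ ≤ ‖v s - a‖ + ‖a‖ := norm_add_le _ _
      _ < ρ / 2 := by linarith
  · simp only [Pi.smul_apply, smul_smul]
    rw [mul_right_comm, mul_inv_cancel₀ hc, one_mul]
    exact hk s

/-- A curve starting in the ball of radius `ρ / 4`, whose speed is at most `η` times its norm as
long as it is inside the ball of radius `ρ`, stays in the ball of radius `ρ / 2` until time `T`,
provided `η * T ≤ 1 / 2`. -/
theorem norm_le_half_of_norm_deriv_le_mul_norm {E : Type*} [NormedAddCommGroup E]
    [NormedSpace ℝ E] {v v' : ℝ → E} {ρ η T : ℝ} (hρ : 0 < ρ) (hη : 0 < η) (hηT : η * T ≤ 1 / 2)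
    (hv : ∀ t ∈ Set.Icc 0 T, HasDerivWithinAt v (v' t) (Set.Icc 0 T) t)
    (hv' : ∀ t ∈ Set.Icc 0 T, ‖v t‖ < ρ → ‖v' t‖ ≤ η * ‖v t‖) (hv0 : ‖v 0‖ < ρ / 4) :
    ∀ t ∈ Set.Icc 0 T, ‖v t‖ ≤ ρ / 2 := by
  have key := image_norm_le_of_norm_deriv_right_lt_deriv_boundary (f := v) (f' := v')
    (a := 0) (b := T) (B := fun t => ρ / 4 + η * ρ / 2 * t) (B' := fun _ => η * ρ / 2)
    (fun t ht => (hv t ht).continuousWithinAt)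
    (fun t ht => (hv t ⟨ht.1, ht.2.le⟩).mono_of_mem_nhdsWithin (Icc_mem_nhdsGE_of_mem ht))
    (by simpa using hv0.le)
    (fun t => by simpa using ((hasDerivAt_id t).const_mul (η * ρ / 2)).const_add (ρ / 4))
    (fun t ht heq => ?_)
  · intro t ht
    have h1 := key ht
    have h2 : η * t ≤ η * T := by gcongr; exact ht.2
    nlinarith
  · have h2 : η * t < η * T := by gcongr; exact ht.2
    have h3 : ‖v t‖ < ρ / 2 := by
      rw [heq]
      nlinarith
    have h4 := hv' t ⟨ht.1, ht.2.le⟩ (by linarith)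
    nlinarith

open Metric in
/-- Holomorphic functions `w` on a disc with `w 1 = γ 0` approximate, arbitrarily well on the unit
circle, the solution `γ` of `γ' = I * ω * γ + h γ` seen in the frame rotating at speed `ω`. -/
theorem exists_holomorphic_approx_of_rotating_solution {E : Type*} [NormedAddCommGroup E]
    [NormedSpace ℂ E] [CompleteSpace E] {h : E → E} {ρ η ω T : ℝ} (hω : ω ≠ 0) (hρ : 0 < ρ)
    (hη : 0 < η) (hηω : 3 * η < |ω|) (hηT : η * T ≤ 1 / 2)
    (hd : DifferentiableOn ℂ h (ball 0 ρ)) (h0 : h 0 = 0) (hd0 : fderiv ℂ h 0 = 0)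
    (hlip : ∀ x ∈ ball (0 : E) ρ, ∀ y ∈ ball (0 : E) ρ, ‖h y - h x‖ ≤ η * ‖y - x‖)
    {v : ℝ → E} (hv0 : ‖v 0‖ < ρ / 4)
    (hv : ∀ t ∈ Set.Icc 0 T, HasDerivWithinAt v
      (Complex.exp (-(t * ω * Complex.I)) • h (Complex.exp (t * ω * Complex.I) • v t))
      (Set.Icc 0 T) t) (m : ℕ) :
    ∃ w : ℂ → E, w 1 = v 0 ∧ (∀ s ∈ ball (0 : ℂ) 2, ‖w s‖ < ρ / 2) ∧
      DifferentiableOn ℂ w (ball 0 2) ∧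
      ∀ t ∈ Set.Icc 0 T, ‖w (Complex.exp (t * ω * Complex.I)) - v t‖ ≤ ρ * (1 / 2) ^ m := by
  have hexp : ∀ t : ℝ, ‖Complex.exp (t * ω * Complex.I)‖ = 1 := fun t => by
    rw [← Complex.ofReal_mul, Complex.norm_exp_ofReal_mul_I]
  have hexp' : ∀ t : ℝ, ‖Complex.exp (-(t * ω * Complex.I))‖ = 1 := fun t => by
    rw [Complex.exp_neg, norm_inv, hexp, inv_one]
  have hexp2 : ∀ t : ℝ, Complex.exp (t * ω * Complex.I) ∈ ball (0 : ℂ) 2 := fun t => by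
    rw [mem_ball_zero_iff, hexp]
    norm_num
  have hlin : ∀ x ∈ ball (0 : E) ρ, ‖h x‖ ≤ η * ‖x‖ := fun x hx => by
    simpa [h0] using hlip 0 (mem_ball_self hρ) x hx
  have hvb : ∀ t ∈ Set.Icc 0 T, ‖v t‖ ≤ ρ / 2 := by
    refine norm_le_half_of_norm_deriv_le_mul_norm hρ hη hηT hv (fun t _ hvt => ?_) hv0
    have hn : ‖Complex.exp (t * ω * Complex.I) • v t‖ = ‖v t‖ := by
      rw [norm_smul, hexp, one_mul]
    rw [norm_smul, hexp', one_mul, ← hn]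
    exact hlin _ (by rwa [mem_ball_zero_iff, hn])
  induction m with
  | zero =>
    refine ⟨fun _ => v 0, rfl, fun _ _ => by linarith, differentiableOn_const _, fun t ht => ?_⟩
    refine (norm_sub_le _ _).trans ?_
    linarith [hvb t ht]
  | succ m ih =>
    obtain ⟨w, -, hwb, hwd, hwv⟩ := ih
    obtain ⟨u, hu1, hub, u', hu', huw⟩ := exists_picard_step (c := Complex.I * ω) (by simp [hω])
      hρ hη (by simpa using hηω) hd h0 hd0
      (fun x hx => (hlin x hx).trans (by have := mem_ball_zero_iff.1 hx; gcongr)) hv0 hwd hwb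
    refine ⟨u, hu1, hub, fun s hs => (hu' s hs).differentiableAt.differentiableWithinAt,
      fun t ht => ?_⟩
    have hder : ∀ t ∈ Set.Icc 0 T, HasDerivWithinAt
        (fun t : ℝ => u (Complex.exp (t * ω * Complex.I)) - v t)
        (Complex.exp (-(t * ω * Complex.I)) •
          (h (Complex.exp (t * ω * Complex.I) • w (Complex.exp (t * ω * Complex.I))) -
            h (Complex.exp (t * ω * Complex.I) • v t))) (Set.Icc 0 T) t := by
      intro t ht
      rw [smul_sub]
      refine HasDerivWithinAt.sub ?_ (hv t ht)
      have h1 : HasDerivAt (fun t : ℝ => Complex.exp (t * ω * Complex.I))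
          (Complex.exp (t * ω * Complex.I) * (ω * Complex.I)) t := by
        have := (((hasDerivAt_id t).ofReal_comp.mul_const (ω : ℂ)).mul_const Complex.I).cexp
        simpa using this
      have h2 := (hu' _ (hexp2 t)).scomp t h1
      refine (h2.congr_deriv ?_).hasDerivWithinAt
      rw [huw, smul_smul, Complex.exp_neg]
      congr 1
      field_simp
    have hle := norm_image_sub_le_of_norm_deriv_le_segment' hder (C := η * (ρ * (1 / 2) ^ m))
      (fun t ht => ?_) t ht
    · simp only [Complex.ofReal_zero, zero_mul, Complex.exp_zero, hu1, sub_self, sub_zero] at hle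
      refine hle.trans ?_
      have : η * t ≤ 1 / 2 := le_trans (by gcongr; exact ht.2) hηT
      calc η * (ρ * (1 / 2) ^ m) * t = ρ * (1 / 2) ^ m * (η * t) := by ring
        _ ≤ ρ * (1 / 2) ^ m * (1 / 2) := by gcongr
        _ = ρ * (1 / 2) ^ (m + 1) := by ring
    · have ht' : t ∈ Set.Icc 0 T := ⟨ht.1, ht.2.le⟩
      have hmem : ∀ x : E, ‖x‖ ≤ ρ / 2 → Complex.exp (t * ω * Complex.I) • x ∈ ball (0 : E) ρ := by
        intro x hx
        rw [mem_ball_zero_iff, norm_smul, hexp]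
        linarith
      rw [norm_smul, hexp', one_mul]
      refine (hlip _ (hmem _ (hvb t ht')) _ (hmem _ (hwb _ (hexp2 t)).le)).trans ?_
      rw [← smul_sub, norm_smul, hexp, one_mul]
      gcongr
      exact hwv t ht'

/-- **Poincaré's Isochronous Center Theorem (return after time `2π/|ω|`).**
If `F` is holomorphic on a ball `Δⁿ ⊆ ℂⁿ` around `0` with `F 0 = 0` and `F'(0) = iω·I`
for a nonzero real `ω`, then there is `ε > 0`, with the closed ball of radius `ε` contained
in `Δⁿ`, such that every solution of `ż = F z` on `[0, 2π/|ω|]` starting at a point of norm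
`< ε` returns to its initial point after time `T = 2π/|ω|`. -/
theorem isochronous_center_return (n : ℕ) (hn : 0 < n) (R : ℝ) (hR : 0 < R)
    (F : EuclideanSpace ℂ (Fin n) → EuclideanSpace ℂ (Fin n))
    (hF : DifferentiableOn ℂ F (Metric.ball 0 R)) (hF0 : F 0 = 0)
    (ω : ℝ) (hω : ω ≠ 0)
    (hdF : fderiv ℂ F 0
      = (Complex.I * (ω : ℂ)) • ContinuousLinearMap.id ℂ (EuclideanSpace ℂ (Fin n))) :
    ∃ ε > 0, Metric.closedBall (0 : EuclideanSpace ℂ (Fin n)) ε ⊆ Metric.ball 0 R ∧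
      ∀ γ : ℝ → EuclideanSpace ℂ (Fin n),
        (∀ t ∈ Set.Icc (0 : ℝ) (2 * Real.pi / |ω|),
          γ t ∈ Metric.ball (0 : EuclideanSpace ℂ (Fin n)) R) →
        (∀ t ∈ Set.Icc (0 : ℝ) (2 * Real.pi / |ω|),
          HasDerivWithinAt γ (F (γ t)) (Set.Icc (0 : ℝ) (2 * Real.pi / |ω|)) t) →
        ‖γ 0‖ < ε → γ (2 * Real.pi / |ω|) = γ 0 := by
  set T := 2 * Real.pi / |ω| with hT
  have hω' : 0 < |ω| := abs_pos.2 hω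
  have hTω : T * |ω| = 2 * Real.pi := div_mul_cancel₀ _ hω'.ne'
  have hTpos : 0 < T := by positivity
  set c : ℂ := Complex.I * ω with hc
  set h : EuclideanSpace ℂ (Fin n) → EuclideanSpace ℂ (Fin n) := fun z => F z - c • z with hh
  have hd : DifferentiableOn ℂ h (Metric.ball 0 R) :=
    hF.sub (differentiableOn_id.const_smul c)
  have h0 : h 0 = 0 := by simp [hh, hF0]
  have hd0 : fderiv ℂ h 0 = 0 := by
    have h1 := (hF.differentiableAt (Metric.ball_mem_nhds 0 hR)).hasFDerivAt
    rw [hdF] at h1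
    have h2 := h1.sub ((hasFDerivAt_id (0 : EuclideanSpace ℂ (Fin n))).const_smul c)
    rw [sub_self] at h2
    exact h2.fderiv
  have hηT : |ω| / 16 * T ≤ 1 / 2 := by
    have : |ω| / 16 * T = 2 * Real.pi / 16 := by rw [← hTω]; ring
    linarith [Real.pi_le_four]
  obtain ⟨ρ, hρ, hρR, hlip⟩ := exists_ball_lipschitz_of_fderiv_eq_zero hR hd h0 hd0
    (show 0 < |ω| / 16 by positivity)
  refine ⟨ρ / 4, by positivity, Metric.closedBall_subset_ball (by linarith),
    fun γ _ hγ hγ0 => ?_⟩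
  have hper : Complex.exp (T * ω * Complex.I) = 1 := by
    rcases abs_choice ω with hs | hs
    · rw [hs] at hTω
      rw [← Complex.ofReal_mul, hTω]
      simp
    · have : T * ω = -(2 * Real.pi) := by rw [← hTω, hs]; ring
      rw [← Complex.ofReal_mul, this, Complex.ofReal_neg, neg_mul, Complex.exp_neg, inv_eq_one]
      simp
  have hv : ∀ t ∈ Set.Icc 0 T, HasDerivWithinAt
      (fun t : ℝ => Complex.exp (-(t * ω * Complex.I)) • γ t)
      (Complex.exp (-(t * ω * Complex.I)) • h (Complex.exp (t * ω * Complex.I) •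
        Complex.exp (-(t * ω * Complex.I)) • γ t)) (Set.Icc 0 T) t := by
    intro t ht
    have h1 : HasDerivAt (fun t : ℝ => Complex.exp (-(t * ω * Complex.I)))
        (Complex.exp (-(t * ω * Complex.I)) * -(ω * Complex.I)) t := by
      have := (((hasDerivAt_id t).ofReal_comp.mul_const (ω : ℂ)).mul_const Complex.I).fun_neg.cexp
      simpa using this
    refine (h1.hasDerivWithinAt.smul (hγ t ht)).congr_deriv ?_
    rw [smul_smul (Complex.exp _) (Complex.exp _) (γ t), ← Complex.exp_add, add_neg_cancel,
      Complex.exp_zero, one_smul, hh, hc]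
    module
  have hzero : ‖γ T - γ 0‖ ≤ 0 := by
    have hlim : Tendsto (fun m : ℕ => ρ * (1 / 2 : ℝ) ^ m) atTop (nhds 0) := by
      simpa using (tendsto_pow_atTop_nhds_zero_of_lt_one (r := (1 / 2 : ℝ))
        (by norm_num) (by norm_num)).const_mul ρ
    refine ge_of_tendsto' hlim fun m => ?_
    obtain ⟨w, hw1, -, -, hw⟩ := exists_holomorphic_approx_of_rotating_solution hω hρ
      (show 0 < |ω| / 16 by positivity) (by linarith) hηT
      (hd.mono (Metric.ball_subset_ball hρR.le)) h0 hd0 hlip (by simpa using hγ0) hv m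
    have := hw T ⟨hTpos.le, le_rfl⟩
    rw [hper, hw1, Complex.exp_neg (T * ω * Complex.I), hper] at this
    simpa [norm_sub_rev] using this
  exact sub_eq_zero.1 (norm_le_zero_iff.1 hzero)
end

section
/- Let F : Δⁿ → ℂⁿ be a holomorphic map on an open ball Δⁿ ⊆ ℂⁿ centered at the origin with F(0) = 0 and F'(0) = iω·I for some nonzero real number ω, and set T = 2π/|ω|. Then there exists ε > 0 such that for every nonconstant differentiable curve γ : ℝ → ℂⁿ with γ(t) ∈ B(0,ε) \ {0} for all t, γ'(t) = F(γ(t)) for all t, and γ(t + p) = γ(t) for all t for some real p > 0, one has p ≥ T. In other words, in a sufficiently small punctured neighborhood of the origin, no periodic orbit has period smaller than 2π/|ω|; combined with the fact that 2π/|ω| is a period of every such orbit, the origin is an isochronous center with (smallest) period 2π/|ω|. -/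
open Asymptotics Filter

open Metric Set
open scoped Topology NNReal

section HolomorphicDisc

variable {E : Type*} [NormedAddCommGroup E] [NormedSpace ℂ E]

/-- A holomorphic map vanishing to second order at the origin has an arbitrarily small Lipschitz
constant on small balls. -/
theorem exists_lipschitzOnWith_ball_of_fderiv_eq_zero {g : E → E} {R : ℝ} (hR : 0 < R)
    (hg : DifferentiableOn ℂ g (ball 0 R)) (hg0 : g 0 = 0) (hdg : fderiv ℂ g 0 = 0)
    {c : ℝ≥0} (hc : 0 < c) :
    ∃ ρ > 0, ρ ≤ R ∧ LipschitzOnWith c g (ball 0 ρ) := by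
  have h0 : HasFDerivAt g (0 : E →L[ℂ] E) 0 := by
    rw [← hdg]
    exact (hg.differentiableAt (ball_mem_nhds 0 hR)).hasFDerivAt
  have hlo := h0.isLittleO.def (c := (c : ℝ) / 4) (by positivity)
  obtain ⟨δ, hδ, hball⟩ := eventually_nhds_iff_ball.1 hlo
  simp only [hg0, sub_zero, zero_apply] at hball
  have hm : 0 < min δ R := lt_min hδ hR
  refine ⟨min δ R / 2, by positivity, by linarith [min_le_right δ R], ?_⟩
  set ρ := min δ R / 2 with hρ
  have hδ' : 2 * ρ ≤ δ := by linarith [min_le_left δ R]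
  have hR' : 2 * ρ ≤ R := by linarith [min_le_right δ R]
  have hsub : ∀ z ∈ ball (0 : E) ρ, ball z ρ ⊆ ball 0 (2 * ρ) := fun z hz =>
    ball_subset_ball' (by rw [mem_ball] at hz; linarith)
  refine (convex_ball 0 ρ).lipschitzOnWith_of_nnnorm_fderiv_le (𝕜 := ℂ)
    (fun z hz => hg.differentiableAt (isOpen_ball.mem_nhds
      (ball_subset_ball (by linarith) hz))) fun z hz => ?_
  have hmaps : MapsTo g (ball z ρ) (closedBall (g z) (c * ρ)) := by
    intro y hy
    have hy' := hsub z hz hy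
    have h1 := hball y (ball_subset_ball hδ' hy')
    have h2 := hball z (ball_subset_ball (by linarith) hz)
    rw [mem_ball_zero_iff] at hz hy'
    rw [mem_closedBall, dist_eq_norm]
    have hc' : (0 : ℝ) < c := hc
    calc ‖g y - g z‖ ≤ ‖g y‖ + ‖g z‖ := norm_sub_le _ _
      _ ≤ c / 4 * (2 * ρ) + c / 4 * ρ := by
        refine add_le_add (h1.trans ?_) (h2.trans ?_) <;> gcongr
      _ ≤ c * ρ := by nlinarith
  have := Complex.norm_fderiv_le_div_of_mapsTo_ball
    (hg.mono ((hsub z hz).trans (ball_subset_ball hR'))) hmaps (by positivity)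
  rw [mul_div_cancel_right₀ _ (by positivity)] at this
  exact_mod_cast this

/-- The second-order difference quotient at the origin, equal to `f w / w ^ 2` for `w ≠ 0` when
`f` vanishes to second order there. -/
noncomputable def dslopeTwice (f : ℂ → E) : ℂ → E := dslope (dslope f 0) 0

theorem dslopeTwice_of_ne {f : ℂ → E} (h0 : f 0 = 0) (hd : deriv f 0 = 0) {w : ℂ} (hw : w ≠ 0) :
    dslopeTwice f w = (w ^ 2)⁻¹ • f w := by
  simp only [dslopeTwice, dslope_of_ne _ hw, dslope_same, slope_def_module, h0, hd, sub_zero,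
    smul_smul]
  congr 1
  field_simp

theorem dslope_fun_sub {f g : ℂ → E} {a : ℂ} (hf : DifferentiableAt ℂ f a)
    (hg : DifferentiableAt ℂ g a) :
    dslope (fun w => f w - g w) a = fun w => dslope f a w - dslope g a w := by
  funext w
  rcases eq_or_ne w a with rfl | hw
  · simp only [dslope_same, deriv_fun_sub hf hg]
  · simp only [dslope_of_ne _ hw, slope_def_module, ← smul_sub]
    congr 1
    abel

/-- The admissible holomorphic discs `w ↦ w • K w` with value `x` at `w = 1`, described by `K`. -/
def IsNearlyLinearDisc (x : E) (K : ℂ → E) : Prop :=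
  DifferentiableOn ℂ K (ball 0 2) ∧ ∀ w ∈ ball (0 : ℂ) 2, ‖K w - x‖ ≤ ‖x‖ / 9 * ‖w - 1‖

theorem IsNearlyLinearDisc.norm_smul_le {x : E} {K : ℂ → E} (hK : IsNearlyLinearDisc x K) {w : ℂ}
    (hw : w ∈ ball (0 : ℂ) 2) : ‖w • K w‖ ≤ 8 / 3 * ‖x‖ := by
  have h1 := hK.2 w hw
  rw [mem_ball_zero_iff] at hw
  have h2 : ‖w - 1‖ ≤ 3 := (norm_sub_le _ _).trans (by rw [norm_one]; linarith)
  have h3 : ‖K w‖ ≤ ‖x‖ + ‖x‖ / 9 * 3 := by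
    have h4 : ‖K w‖ ≤ ‖x‖ + ‖K w - x‖ := by
      simpa using norm_add_le x (K w - x)
    have : ‖x‖ / 9 * ‖w - 1‖ ≤ ‖x‖ / 9 * 3 := by gcongr
    linarith
  rw [norm_smul]
  calc ‖w‖ * ‖K w‖ ≤ 2 * (‖x‖ + ‖x‖ / 9 * 3) := by gcongr
    _ = 8 / 3 * ‖x‖ := by ring

variable {g : E → E} {ρ : ℝ} {x : E}

theorem IsNearlyLinearDisc.mem_ball {K : ℂ → E} (hK : IsNearlyLinearDisc x K)
    (hx : ‖x‖ < ρ / 3) {w : ℂ} (hw : w ∈ ball (0 : ℂ) 2) : w • K w ∈ ball (0 : E) ρ := by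
  rw [mem_ball_zero_iff]
  linarith [hK.norm_smul_le hw, norm_nonneg x]

theorem IsNearlyLinearDisc.differentiableOn_comp {K : ℂ → E} (hK : IsNearlyLinearDisc x K)
    (hx : ‖x‖ < ρ / 3) (hg : DifferentiableOn ℂ g (ball 0 ρ)) :
    DifferentiableOn ℂ (fun w => g (w • K w)) (ball 0 2) :=
  hg.comp (differentiableOn_id.smul hK.1) fun _ hw => hK.mem_ball hx hw

theorem IsNearlyLinearDisc.deriv_comp_zero {K : ℂ → E} (hK : IsNearlyLinearDisc x K)
    (hdg : HasFDerivAt g (0 : E →L[ℂ] E) 0) : deriv (fun w => g (w • K w)) 0 = 0 := by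
  have hK0 := hK.1.differentiableAt (ball_mem_nhds (0 : ℂ) two_pos)
  have h1 := (hasDerivAt_id (0 : ℂ)).smul hK0.hasDerivAt
  have h2 : HasFDerivAt g (0 : E →L[ℂ] E) ((0 : ℂ) • K 0) := by simpa using hdg
  exact (h2.comp_hasDerivAt (0 : ℂ) h1).deriv.trans (by simp)

variable [CompleteSpace E]

theorem differentiableOn_dslopeTwice {f : ℂ → E} {r : ℝ} (hr : 0 < r)
    (hf : DifferentiableOn ℂ f (ball 0 r)) : DifferentiableOn ℂ (dslopeTwice f) (ball 0 r) := by
  have h := ball_mem_nhds (0 : ℂ) hr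
  exact (Complex.differentiableOn_dslope h).2 ((Complex.differentiableOn_dslope h).2 hf)

theorem dslopeTwice_fun_sub {f g : ℂ → E} {r : ℝ} (hr : 0 < r)
    (hf : DifferentiableOn ℂ f (ball 0 r)) (hg : DifferentiableOn ℂ g (ball 0 r)) (w : ℂ) :
    dslopeTwice (fun w => f w - g w) w = dslopeTwice f w - dslopeTwice g w := by
  have h := ball_mem_nhds (0 : ℂ) hr
  rw [dslopeTwice, dslope_fun_sub (hf.differentiableAt h) (hg.differentiableAt h),
    dslope_fun_sub (((Complex.differentiableOn_dslope h).2 hf).differentiableAt h)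
      (((Complex.differentiableOn_dslope h).2 hg).differentiableAt h)]
  rfl

theorem norm_dslopeTwice_le {f : ℂ → E} {r M : ℝ}
    (hf : DifferentiableOn ℂ f (ball 0 r)) (h0 : f 0 = 0) (hd : deriv f 0 = 0)
    (hM : ∀ w ∈ ball (0 : ℂ) r, ‖f w‖ ≤ M) {w : ℂ} (hw : w ∈ ball (0 : ℂ) r) :
    ‖dslopeTwice f w‖ ≤ M / r ^ 2 := by
  have h := ball_mem_nhds (0 : ℂ) (pos_of_mem_ball hw)
  have h1 : ∀ z ∈ ball (0 : ℂ) r, ‖dslope f 0 z‖ ≤ M / r := fun z hz =>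
    Complex.norm_dslope_le_div_of_mapsTo_ball hf
      (fun y hy => by simpa [h0] using hM y hy) hz
  have h2 := Complex.norm_dslope_le_div_of_mapsTo_ball ((Complex.differentiableOn_dslope h).2 hf)
      (fun y hy => by simpa [hd] using h1 y hy) hw
  rwa [div_div, ← sq] at h2

/-- A primitive of `dslopeTwice f` is Lipschitz about `1`. -/
theorem norm_sub_le_of_hasDerivAt_dslopeTwice {f K : ℂ → E} {M : ℝ}
    (hf : DifferentiableOn ℂ f (ball 0 2)) (h0 : f 0 = 0) (hd : deriv f 0 = 0)
    (hM : ∀ w ∈ ball (0 : ℂ) 2, ‖f w‖ ≤ M)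
    (hK : ∀ w ∈ ball (0 : ℂ) 2, HasDerivAt K (dslopeTwice f w) w)
    {w : ℂ} (hw : w ∈ ball (0 : ℂ) 2) :
    ‖K w - K 1‖ ≤ M / 4 * ‖w - 1‖ := by
  refine (convex_ball (0 : ℂ) 2).norm_image_sub_le_of_norm_hasDerivWithin_le
    (fun z hz => (hK z hz).hasDerivWithinAt) (fun z hz => ?_) (by simp) hw
  convert norm_dslopeTwice_le hf h0 hd hM hz using 2
  norm_num

theorem IsNearlyLinearDisc.exists_next {K : ℂ → E} (hK : IsNearlyLinearDisc x K)
    (hx : ‖x‖ < ρ / 3) (hg : DifferentiableOn ℂ g (ball 0 ρ)) (hg0 : g 0 = 0)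
    (hdg : HasFDerivAt g (0 : E →L[ℂ] E) 0) (hL : LipschitzOnWith (1 / 6) g (ball 0 ρ)) :
    ∃ K' : ℂ → E, IsNearlyLinearDisc x K' ∧ K' 1 = x ∧
      ∀ w ∈ ball (0 : ℂ) 2, HasDerivAt K' (dslopeTwice (fun w => g (w • K w)) w) w := by
  have hf := hK.differentiableOn_comp hx hg
  obtain ⟨K', hK'1, hK'⟩ :=
    (differentiableOn_dslopeTwice two_pos hf).isExactOn_ball.with_val_at 1 x
  refine ⟨K', ⟨fun w hw => (hK' w hw).differentiableAt.differentiableWithinAt, fun w hw => ?_⟩,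
    hK'1, hK'⟩
  have hM : ∀ w ∈ ball (0 : ℂ) 2, ‖g (w • K w)‖ ≤ 4 / 9 * ‖x‖ := fun z hz => by
    have h1 := hL.dist_le_mul _ (hK.mem_ball hx hz) 0
      (mem_ball_self (by linarith [norm_nonneg x]))
    rw [hg0, dist_zero_right, dist_zero_right] at h1
    push_cast at h1
    linarith [hK.norm_smul_le hz]
  have := norm_sub_le_of_hasDerivAt_dslopeTwice hf (by simp [hg0]) (hK.deriv_comp_zero hdg) hM
    hK' hw
  rw [hK'1] at this
  convert this using 2
  ring

theorem IsNearlyLinearDisc.norm_next_sub_next_le {K₁ K₂ K₁' K₂' : ℂ → E}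
    (hK₁ : IsNearlyLinearDisc x K₁) (hK₂ : IsNearlyLinearDisc x K₂)
    (hx : ‖x‖ < ρ / 3) (hg : DifferentiableOn ℂ g (ball 0 ρ))
    (hdg : HasFDerivAt g (0 : E →L[ℂ] E) 0) (hL : LipschitzOnWith (1 / 6) g (ball 0 ρ))
    (h₁ : K₁' 1 = x) (h₂ : K₂' 1 = x)
    (hd₁ : ∀ w ∈ ball (0 : ℂ) 2, HasDerivAt K₁' (dslopeTwice (fun w => g (w • K₁ w)) w) w)
    (hd₂ : ∀ w ∈ ball (0 : ℂ) 2, HasDerivAt K₂' (dslopeTwice (fun w => g (w • K₂ w)) w) w)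
    {C : ℝ} (hC : ∀ w ∈ ball (0 : ℂ) 2, ‖K₁ w - K₂ w‖ ≤ C) {w : ℂ} (hw : w ∈ ball (0 : ℂ) 2) :
    ‖K₁' w - K₂' w‖ ≤ C / 4 := by
  have hf₁ := hK₁.differentiableOn_comp hx hg
  have hf₂ := hK₂.differentiableOn_comp hx hg
  have h20 := ball_mem_nhds (0 : ℂ) two_pos
  have hC0 : 0 ≤ C := (norm_nonneg _).trans (hC w hw)
  have hM : ∀ w ∈ ball (0 : ℂ) 2, ‖g (w • K₁ w) - g (w • K₂ w)‖ ≤ C / 3 := fun z hz => by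
    have h1 := hL.dist_le_mul _ (hK₁.mem_ball hx hz) _ (hK₂.mem_ball hx hz)
    rw [dist_eq_norm, dist_eq_norm, ← smul_sub, norm_smul] at h1
    push_cast at h1
    have h2 : ‖z‖ * ‖K₁ z - K₂ z‖ ≤ 2 * C := by
      have := hC z hz
      rw [mem_ball_zero_iff] at hz
      gcongr
    linarith
  have key := norm_sub_le_of_hasDerivAt_dslopeTwice (K := fun w => K₁' w - K₂' w)
    (hf₁.fun_sub hf₂) (by simp)
    (by rw [deriv_fun_sub (hf₁.differentiableAt h20) (hf₂.differentiableAt h20),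
          hK₁.deriv_comp_zero hdg, hK₂.deriv_comp_zero hdg, sub_zero])
    hM (fun z hz => by
      rw [dslopeTwice_fun_sub two_pos hf₁ hf₂]
      exact (hd₁ z hz).fun_sub (hd₂ z hz)) hw
  rw [h₁, h₂, sub_self, sub_zero] at key
  have h3 : ‖w - 1‖ ≤ 3 := by
    rw [mem_ball_zero_iff] at hw
    exact (norm_sub_le _ _).trans (by rw [norm_one]; linarith)
  have : C / 3 / 4 * ‖w - 1‖ ≤ C / 3 / 4 * 3 := by gcongr
  linarith

/-- Existence of the holomorphic disc `h w = w • K w` through `x` solving `w h' = h + g h`. -/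
theorem exists_isNearlyLinearDisc_hasDerivAt
    (hx : ‖x‖ < ρ / 3) (hg : DifferentiableOn ℂ g (ball 0 ρ)) (hg0 : g 0 = 0)
    (hdg : HasFDerivAt g (0 : E →L[ℂ] E) 0) (hL : LipschitzOnWith (1 / 6) g (ball 0 ρ)) :
    ∃ K : ℂ → E, IsNearlyLinearDisc x K ∧
      ∀ w ∈ ball (0 : ℂ) 2, w ≠ 0 → HasDerivAt K ((w ^ 2)⁻¹ • g (w • K w)) w := by
  choose next hnext hnext1 hnextd using
    fun K : {K : ℂ → E // IsNearlyLinearDisc x K} => K.2.exists_next hx hg hg0 hdg hL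
  have hinit : IsNearlyLinearDisc x fun _ => x :=
    ⟨differentiableOn_const x, fun w _ => by simp; positivity⟩
  let u : ℕ → {K : ℂ → E // IsNearlyLinearDisc x K} :=
    fun n => (fun K => ⟨next K, hnext K⟩)^[n] ⟨_, hinit⟩
  have hu : ∀ n, (u (n + 1)).1 = next (u n) := fun n => by
    simp only [u, Function.iterate_succ_apply']
  have hstep : ∀ n, ∀ w ∈ ball (0 : ℂ) 2,
      ‖(u n).1 w - (u (n + 1)).1 w‖ ≤ ‖x‖ / 3 * (1 / 4) ^ n := by
    intro n
    induction n with
    | zero =>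
      intro w hw
      have h1 := (u 1).2.2 w hw
      have h2 : ‖w - 1‖ ≤ 3 := by
        rw [mem_ball_zero_iff] at hw
        exact (norm_sub_le _ _).trans (by rw [norm_one]; linarith)
      have h3 : ‖x‖ / 9 * ‖w - 1‖ ≤ ‖x‖ / 9 * 3 := by gcongr
      rw [norm_sub_rev]
      change ‖(u 1).1 w - x‖ ≤ _
      linarith
    | succ n ih =>
      intro w hw
      have := (u n).2.norm_next_sub_next_le (u (n + 1)).2 hx hg hdg hL (hnext1 (u n))
        (hnext1 (u (n + 1))) (hnextd (u n)) (hnextd (u (n + 1))) ih hw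
      rw [hu, hu, pow_succ]
      linarith
  have hlim : ∀ w ∈ ball (0 : ℂ) 2, ∃ y, Tendsto (fun n => (u n).1 w) atTop (𝓝 y) := fun w hw =>
    cauchySeq_tendsto_of_complete (cauchySeq_of_le_geometric (1 / 4) (‖x‖ / 3) (by norm_num)
      fun n => by rw [dist_eq_norm]; exact hstep n w hw)
  choose! K hK using hlim
  have hunif : TendstoUniformlyOn (fun n => (u n).1) K atTop (ball 0 2) := by
    rw [Metric.tendstoUniformlyOn_iff]
    intro ε hε
    have h0 : Tendsto (fun n : ℕ => ‖x‖ / 3 * (1 / 4 : ℝ) ^ n / (1 - 1 / 4)) atTop (𝓝 0) := by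
      simpa using ((tendsto_pow_atTop_nhds_zero_of_lt_one (r := (1 / 4 : ℝ)) (by norm_num)
        (by norm_num)).const_mul (‖x‖ / 3)).div_const (1 - 1 / 4)
    filter_upwards [h0.eventually_lt_const hε] with n hn w hw
    rw [dist_comm]
    exact (dist_le_of_le_geometric_of_tendsto (1 / 4) (‖x‖ / 3) (by norm_num)
      (fun n => by rw [dist_eq_norm]; exact hstep n w hw) (hK w hw) n).trans_lt hn
  have hloc := hunif.tendstoLocallyUniformlyOn
  have hdiff : ∀ᶠ n in atTop, DifferentiableOn ℂ (u n).1 (ball 0 2) :=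
    Eventually.of_forall fun n => (u n).2.1
  have hKdiff := hloc.differentiableOn hdiff isOpen_ball
  have hdisc : IsNearlyLinearDisc x K := ⟨hKdiff, fun w hw =>
    le_of_tendsto ((hK w hw).sub_const x).norm (Eventually.of_forall fun n => (u n).2.2 w hw)⟩
  refine ⟨K, hdisc, fun w hw hw0 => ?_⟩
  have hderiv := ((hloc.deriv hdiff isOpen_ball).tendsto_at hw).comp (tendsto_add_atTop_nat 1)
  have hgw : Tendsto (fun n => (w ^ 2)⁻¹ • g (w • (u n).1 w)) atTop
      (𝓝 ((w ^ 2)⁻¹ • g (w • K w))) :=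
    (((hg.differentiableAt (isOpen_ball.mem_nhds (hdisc.mem_ball hx hw))).continuousAt.tendsto.comp
      ((hK w hw).const_smul w))).const_smul _
  have heq : deriv K w = (w ^ 2)⁻¹ • g (w • K w) := by
    refine tendsto_nhds_unique hderiv (hgw.congr fun n => ?_)
    simp only [Function.comp_apply]
    rw [hu, (hnextd (u n) w hw).deriv,
      dslopeTwice_of_ne (by simp [hg0]) ((u n).2.deriv_comp_zero hdg) hw0]
  rw [← heq]
  exact (hKdiff.differentiableAt (isOpen_ball.mem_nhds hw)).hasDerivAt

/-- Near a singularity with linear part `iω`, every period of a nonzero periodic solution of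
`ż = F z` is at least `2π/|ω|`. -/
theorem exists_ball_two_pi_div_le_period {R : ℝ} (hR : 0 < R) {F : E → E}
    (hF : DifferentiableOn ℂ F (ball 0 R)) (hF0 : F 0 = 0) {ω : ℝ} (hω : ω ≠ 0)
    (hdF : fderiv ℂ F 0 = (Complex.I * (ω : ℂ)) • ContinuousLinearMap.id ℂ E) :
    ∃ ε > 0, ball (0 : E) ε ⊆ ball 0 R ∧
      ∀ (γ : ℝ → E) (p : ℝ), 0 < p → (∀ t, γ t ∈ ball (0 : E) ε \ {0}) →
        (∀ t, HasDerivAt γ (F (γ t)) t) → (∀ t, γ (t + p) = γ t) → 2 * Real.pi / |ω| ≤ p := by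
  set a : ℂ := Complex.I * ω with ha
  have ha0 : a ≠ 0 := mul_ne_zero Complex.I_ne_zero (by exact_mod_cast hω)
  let g : E → E := fun z => a⁻¹ • F z - z
  have hFg : ∀ z, F z = a • (z + g z) := fun z => by simp [g, smul_smul, ha0]
  have hg : DifferentiableOn ℂ g (ball 0 R) := (hF.const_smul _).sub differentiableOn_id
  have hg0 : g 0 = 0 := by simp [g, hF0]
  have hdg : HasFDerivAt g (0 : E →L[ℂ] E) 0 := by
    have h := (((hF.differentiableAt (ball_mem_nhds 0 hR)).hasFDerivAt.const_smul a⁻¹).sub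
      (hasFDerivAt_id (0 : E)))
    rw [hdF, smul_smul, inv_mul_cancel₀ ha0, one_smul, sub_self] at h
    exact h
  obtain ⟨ρ, hρ, hρR, hL⟩ := exists_lipschitzOnWith_ball_of_fderiv_eq_zero hR hg hg0 hdg.fderiv
    (c := 1 / 6) (by norm_num)
  refine ⟨ρ / 3, by positivity, ball_subset_ball (by linarith), ?_⟩
  intro γ p hp hγ hγ' hper
  have hx : ‖γ 0‖ < ρ / 3 := mem_ball_zero_iff.1 (hγ 0).1
  have hx0 : γ 0 ≠ 0 := (hγ 0).2
  obtain ⟨K, hK, hK'⟩ := exists_isNearlyLinearDisc_hasDerivAt hx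
    (hg.mono (ball_subset_ball hρR)) hg0 hdg hL
  have hunit : ∀ t : ℝ, ‖Complex.exp (t * a)‖ = 1 := fun t => by
    rw [ha, show (t : ℂ) * (Complex.I * ω) = ((t * ω : ℝ) : ℂ) * Complex.I by push_cast; ring]
    exact Complex.norm_exp_ofReal_mul_I _
  have hmem : ∀ t : ℝ, Complex.exp (t * a) ∈ ball (0 : ℂ) 2 := fun t => by
    rw [mem_ball_zero_iff, hunit]; norm_num
  have hη : ∀ t : ℝ, HasDerivAt (fun t : ℝ => Complex.exp (t * a) • K (Complex.exp (t * a)))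
      (F (Complex.exp (t * a) • K (Complex.exp (t * a)))) t := by
    intro t
    have hw0 := Complex.exp_ne_zero (t * a)
    have hexp : HasDerivAt (fun t : ℝ => Complex.exp (t * a)) (Complex.exp (t * a) * a) t := by
      have h1 := ((hasDerivAt_id (t : ℂ)).mul_const a).cexp.comp_ofReal
      simpa using h1
    have h2 := ((hasDerivAt_id _).smul (hK' _ (hmem t) hw0)).scomp t hexp
    refine h2.congr_deriv ?_
    rw [hFg]
    simp only [id, smul_add, smul_smul, one_smul]
    rw [add_comm]
    congr 2
    · ring
    · field_simp
  have hLF : LipschitzOnWith (‖a‖₊ * (1 + 1 / 6)) F (ball 0 ρ) := by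
    rw [show F = fun z => a • (z + g z) from funext hFg]
    exact (lipschitzWith_smul a).comp_lipschitzOnWith
      ((LipschitzWith.id.lipschitzOnWith).add hL)
  have huniq := ODE_solution_unique_univ (v := fun _ => F) (s := fun _ => ball 0 ρ) (t₀ := 0)
    (fun _ => hLF) (fun t => ⟨hγ' t, ball_subset_ball (by linarith) (hγ t).1⟩)
    (fun t => ⟨hη t, hK.mem_ball hx (hmem t)⟩)
    (by
      have := hK.2 1 (by simp)
      simp only [sub_self, norm_zero, mul_zero, norm_le_zero_iff] at this
      simp [sub_eq_zero.1 this])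
  have hret : Complex.exp (p * a) • K (Complex.exp (p * a)) = γ 0 := by
    rw [← hper 0, zero_add, huniq]
  have hone : Complex.exp (p * a) = 1 := by
    set w := Complex.exp (p * a)
    have h1 : (w - 1) • γ 0 = -(w • (K w - γ 0)) := by
      rw [smul_sub, hret, sub_smul, one_smul]; abel
    have h2 := congrArg norm h1
    rw [norm_neg, norm_smul, norm_smul, hunit p, one_mul] at h2
    have h3 := hK.2 w (hmem p)
    rw [← h2] at h3
    have h4 : ‖w - 1‖ * ‖γ 0‖ ≤ 0 := by linarith
    have h5 : 0 < ‖γ 0‖ := norm_pos_iff.2 hx0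
    have h6 : ‖w - 1‖ ≤ 0 := by nlinarith
    exact sub_eq_zero.1 (norm_le_zero_iff.1 h6)
  obtain ⟨m, hm⟩ := Complex.exp_eq_one_iff.1 hone
  have hm' : p * ω = m * (2 * Real.pi) := by
    have := congrArg Complex.im hm
    simpa [ha] using this
  have hm0 : m ≠ 0 := by
    rintro rfl
    simp [hp.ne', hω] at hm'
  have hm1 : (1 : ℝ) ≤ |(m : ℝ)| := by exact_mod_cast Int.one_le_abs hm0
  rw [div_le_iff₀ (abs_pos.2 hω)]
  have habs := congrArg abs hm'
  rw [abs_mul, abs_mul, abs_of_pos hp, abs_of_pos Real.two_pi_pos] at habs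
  rw [habs]
  exact le_mul_of_one_le_left Real.two_pi_pos.le hm1

end HolomorphicDisc

/-- Under the hypotheses of Poincaré's Isochronous Center Theorem (`F'(0) = iω·I`, `ω ≠ 0`),
there is `ε > 0` such that every nonconstant periodic solution of `ż = F z` lying entirely in
the punctured ball `B(0,ε) \ {0}` has every positive period `p` at least `T = 2π/|ω|`;
i.e. no periodic orbit in a sufficiently small punctured neighborhood of the origin has
period smaller than `2π/|ω|`. -/
theorem isochronous_center_min_period (n : ℕ) (hn : 0 < n) (R : ℝ) (hR : 0 < R)
    (F : EuclideanSpace ℂ (Fin n) → EuclideanSpace ℂ (Fin n))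
    (hF : DifferentiableOn ℂ F (Metric.ball 0 R)) (hF0 : F 0 = 0)
    (ω : ℝ) (hω : ω ≠ 0)
    (hdF : fderiv ℂ F 0
      = (Complex.I * (ω : ℂ)) • ContinuousLinearMap.id ℂ (EuclideanSpace ℂ (Fin n))) :
    ∃ ε > 0, Metric.ball (0 : EuclideanSpace ℂ (Fin n)) ε ⊆ Metric.ball 0 R ∧
      ∀ (γ : ℝ → EuclideanSpace ℂ (Fin n)) (p : ℝ), 0 < p →
        (∀ t, γ t ∈ Metric.ball (0 : EuclideanSpace ℂ (Fin n)) ε \ {0}) →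
        (∀ t, HasDerivAt γ (F (γ t)) t) →
        (∀ t, γ (t + p) = γ t) →
        (∃ t₁ t₂, γ t₁ ≠ γ t₂) →
        2 * Real.pi / |ω| ≤ p := by
  obtain ⟨ε, hε, hsub, h⟩ := exists_ball_two_pi_div_le_period hR hF hF0 hω hdF
  exact ⟨ε, hε, hsub, fun γ p hp hγ hγ' hper _ => h γ p hp hγ hγ' hper⟩
end

section
/- Let F be a holomorphic map defined on a neighborhood of 0 in ℂⁿ with F(0) = 0, let A = F'(0), and let λ₁, …, λₙ ∈ ℂ be the eigenvalues of A (with multiplicity). Assume (i) the n-tuple (λ₁, …, λₙ) is in the Poincaré domain: the convex hull of {λ₁, …, λₙ} in ℂ does not contain 0; and (ii) there is no resonance: for every n-tuple (i₁, …, iₙ) of nonnegative integers with i₁ + ⋯ + iₙ ≥ 2 and every j ∈ {1, …, n}, λ_j ≠ i₁λ₁ + ⋯ + iₙλₙ. Then the system ż = F(z) is linearizable at the origin: there exist open neighborhoods U, V of 0 in ℂⁿ and a biholomorphic map h : U → V with h(0) = 0 such that for all x ∈ U, F(h(x)) = (h'(x))(A x), where h'(x) denotes the Fréchet derivative of h at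 x; i.e., h transforms the linear system ẋ = A x into ż = F(z). -/
open Asymptotics Filter Polynomial

section Holomorphic

open Metric Topology

variable {E G : Type*} [NormedAddCommGroup E] [NormedSpace ℂ E]
  [NormedAddCommGroup G] [NormedSpace ℂ G]

/-- Cauchy's estimate for the Fréchet derivative. -/
theorem norm_fderiv_le_of_norm_le_on_ball {u : E → G} {x : E} {r M : ℝ} (hr : 0 < r)
    (hu : DifferentiableOn ℂ u (ball x r)) (hM : ∀ y ∈ ball x r, ‖u y‖ ≤ M) :
    ‖fderiv ℂ u x‖ ≤ 2 * M / r := by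
  refine Complex.norm_fderiv_le_div_of_mapsTo_ball hu (fun y hy => ?_) hr
  rw [mem_closedBall, dist_eq_norm]
  linarith [norm_sub_le (u y) (u x), hM y hy, hM x (mem_ball_self hr)]

/-- The Weierstrass theorem: a uniform limit of holomorphic maps is holomorphic. -/
theorem TendstoUniformlyOn.differentiableOn_complex [CompleteSpace G] {u : ℕ → E → G} {v : E → G}
    {U : Set E} (hU : IsOpen U) (hu : ∀ n, DifferentiableOn ℂ (u n) U)
    (huv : TendstoUniformlyOn u v atTop U) : DifferentiableOn ℂ v U := by
  intro x hx
  obtain ⟨r, hr, hrU⟩ := Metric.isOpen_iff.1 hU x hx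
  have hsub : ∀ y ∈ ball x (r / 2), ball y (r / 2) ⊆ U := fun y hy =>
    (ball_subset_ball' (by rw [mem_ball] at hy; linarith)).trans hrU
  have hmem : ∀ y ∈ ball x (r / 2), y ∈ U := fun y hy => hsub y hy (mem_ball_self (by positivity))
  have hdiff : ∀ n, ∀ y ∈ U, DifferentiableAt ℂ (u n) y := fun n y hy =>
    (hu n).differentiableAt (hU.mem_nhds hy)
  have hcauchy : UniformCauchySeqOn (fun n => fderiv ℂ (u n)) atTop (ball x (r / 2)) := by
    rw [Metric.uniformCauchySeqOn_iff]
    intro ε hε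
    obtain ⟨n₀, hn₀⟩ := Metric.uniformCauchySeqOn_iff.1 huv.uniformCauchySeqOn (ε * r / 8)
      (by positivity)
    refine ⟨n₀, fun m hm n hn y hy => ?_⟩
    rw [dist_eq_norm, ← fderiv_sub (hdiff m y (hmem y hy)) (hdiff n y (hmem y hy))]
    have hle := norm_fderiv_le_of_norm_le_on_ball (u := u m - u n) (x := y) (M := ε * r / 8)
      (half_pos hr) (((hu m).sub (hu n)).mono (hsub y hy)) (fun z hz => by
        simpa [dist_eq_norm] using (hn₀ m hm n hn z (hsub y hy hz)).le)
    refine hle.trans_lt ?_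
    rw [div_lt_iff₀ (by positivity)]
    nlinarith
  have hlim : ∀ y ∈ ball x (r / 2), ∃ L, Tendsto (fun n => fderiv ℂ (u n) y) atTop (𝓝 L) :=
    fun y hy => cauchySeq_tendsto_of_complete (hcauchy.cauchy_map hy)
  choose! L hL using hlim
  exact (hasFDerivAt_of_tendstoUniformlyOn isOpen_ball
    (hcauchy.tendstoUniformlyOn_of_tendsto hL)
    (fun n y hy => (hdiff n y (hmem y hy)).hasFDerivAt)
    (fun y hy => huv.tendsto_at (hmem y hy))
    (mem_ball_self (half_pos hr))).differentiableAt.differentiableWithinAt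

/-- The quadratic Taylor remainder of a bounded holomorphic map. -/
theorem norm_sub_sub_fderiv_le {u : E → G} {x y : E} {r M : ℝ}
    (hu : DifferentiableOn ℂ u (ball x r)) (hM : ∀ z ∈ ball x r, ‖u z‖ ≤ M)
    (hy : y ∈ ball x r) :
    ‖u y - u x - fderiv ℂ u x (y - x)‖ ≤ 4 * M * (‖y - x‖ / r) ^ 2 := by
  have hr : 0 < r := nonempty_ball.mp ⟨_, hy⟩
  have hux : DifferentiableAt ℂ u x := hu.differentiableAt (ball_mem_nhds x hr)
  have hfd := norm_fderiv_le_of_norm_le_on_ball hr hu hM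
  have key := Complex.dist_le_mul_div_pow_of_mapsTo_ball_of_isLittleO (n := 1)
    (f := fun z => u z - fderiv ℂ u x (z - x)) (c := x) (z := y) (R₁ := r) (R₂ := 4 * M)
    (hu.sub (by fun_prop)) (fun z hz => ?_) ?_ hy
  · simpa [dist_eq_norm, sub_right_comm] using key
  · have h1 := (fderiv ℂ u x).le_opNorm (z - x)
    have h2 : ‖fderiv ℂ u x‖ * ‖z - x‖ ≤ 2 * M / r * r := by
      have hz' : ‖z - x‖ ≤ r := by simpa [dist_eq_norm] using (mem_ball.1 hz).le
      gcongr
      exact (norm_nonneg _).trans hfd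
    rw [div_mul_cancel₀ _ hr.ne'] at h2
    have h3 := norm_sub_le (u z - u x) (fderiv ℂ u x (z - x))
    have h4 := norm_sub_le (u z) (u x)
    have h5 := hM z hz
    have h6 := hM x (mem_ball_self hr)
    simp only [mem_closedBall, dist_eq_norm, sub_self, map_zero, sub_zero]
    rw [sub_right_comm]
    linarith
  · simpa [sub_right_comm] using hux.hasFDerivAt.isLittleO.norm_right

theorem DifferentiableOn.fderiv_apply_complex [CompleteSpace G] {u : E → G} {U : Set E}
    (hU : IsOpen U) (hu : DifferentiableOn ℂ u U) (v : E) :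
    DifferentiableOn ℂ (fun x => fderiv ℂ u x v) U := by
  intro x hx
  have hcont : ContinuousAt u x := (hu.differentiableAt (hU.mem_nhds hx)).continuousAt
  obtain ⟨r, hr, hrU⟩ : ∃ r > 0, ∀ z ∈ ball x r, z ∈ U ∧ ‖u z‖ ≤ ‖u x‖ + 1 := by
    have h1 : ∀ᶠ z in 𝓝 x, ‖u z‖ < ‖u x‖ + 1 :=
      hcont.norm.eventually (gt_mem_nhds (lt_add_one _))
    obtain ⟨r, hr, h⟩ := Metric.eventually_nhds_iff_ball.1
      ((hU.eventually_mem hx).and h1)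
    exact ⟨r, hr, fun z hz => ⟨(h z hz).1, (h z hz).2.le⟩⟩
  set M := ‖u x‖ + 1
  have hM : 0 < M := by positivity
  have hsub : ∀ y ∈ ball x (r / 2), ball y (r / 2) ⊆ ball x r := fun y hy =>
    ball_subset_ball' (by rw [mem_ball] at hy; linarith)
  obtain ⟨c, hc, hcv⟩ : ∃ c > 0, c * (‖v‖ + 1) = r / 2 :=
    ⟨r / 2 / (‖v‖ + 1), by positivity, by field_simp⟩
  let ε : ℕ → ℝ := fun n => c / (n + 1)
  have hε : ∀ n, 0 < ε n := fun n => by positivity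
  have hεv : ∀ n, ‖(ε n : ℂ) • v‖ < r / 2 := by
    intro n
    have h1 : ε n ≤ c := div_le_self hc.le (by linarith [n.cast_nonneg (α := ℝ)])
    rw [norm_smul, Complex.norm_real, Real.norm_of_nonneg (hε n).le, ← hcv]
    have := norm_nonneg v
    nlinarith
  have hεlim : Tendsto ε atTop (𝓝 0) := by
    simpa [ε, div_eq_mul_inv] using (tendsto_one_div_add_atTop_nhds_zero_nat (𝕜 := ℝ)).const_mul c
  have hmem : ∀ n, ∀ y ∈ ball x (r / 2), y + (ε n : ℂ) • v ∈ ball y (r / 2) := fun n y hy => by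
    simpa [mem_ball, dist_eq_norm] using hεv n
  have hud : ∀ y ∈ ball x r, DifferentiableAt ℂ u y := fun y hy =>
    hu.differentiableAt (hU.mem_nhds (hrU y hy).1)
  have hlim : DifferentiableOn ℂ (fun y => fderiv ℂ u y v) (ball x (r / 2)) := by
    refine TendstoUniformlyOn.differentiableOn_complex isOpen_ball
      (u := fun n y => (ε n : ℂ)⁻¹ • (u (y + (ε n : ℂ) • v) - u y)) (fun n y hy => ?_) ?_
    · have h1 := hud _ (hsub y hy (hmem n y hy))
      have h2 := hud _ (hsub y hy (mem_ball_self (half_pos hr)))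
      exact ((((h1.comp y (f := fun y => y + (ε n : ℂ) • v) (by fun_prop)).sub h2).const_smul
        (ε n : ℂ)⁻¹)).differentiableWithinAt
    · have hz : Tendsto (fun n => ε n * (4 * M * (‖v‖ / (r / 2)) ^ 2)) atTop (𝓝 0) := by
        simpa using hεlim.mul_const (4 * M * (‖v‖ / (r / 2)) ^ 2)
      rw [Metric.tendstoUniformlyOn_iff]
      intro δ hδ
      filter_upwards [hz.eventually (gt_mem_nhds hδ)] with n hn y hy
      refine lt_of_le_of_lt ?_ hn
      have h1 := norm_sub_sub_fderiv_le (M := M)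
        (fun z hz => (hud z (hsub y hy hz)).differentiableWithinAt)
        (fun z hz => (hrU z (hsub y hy hz)).2) (hmem n y hy)
      have hεn : (ε n : ℂ) ≠ 0 := by exact_mod_cast (hε n).ne'
      have h2 : (ε n : ℂ)⁻¹ • (u (y + (ε n : ℂ) • v) - u y) - fderiv ℂ u y v =
          (ε n : ℂ)⁻¹ • (u (y + (ε n : ℂ) • v) - u y - fderiv ℂ u y ((y + (ε n : ℂ) • v) - y)) := by
        rw [add_sub_cancel_left, map_smul, smul_sub _ (_ - _), inv_smul_smul₀ hεn]
      rw [dist_comm, dist_eq_norm, h2, norm_smul, norm_inv, Complex.norm_real,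
        Real.norm_of_nonneg (hε n).le, inv_mul_le_iff₀ (hε n)]
      refine h1.trans_eq ?_
      rw [add_sub_cancel_left, norm_smul, Complex.norm_real, Real.norm_of_nonneg (hε n).le]
      ring
  exact (hlim.differentiableAt (ball_mem_nhds x (half_pos hr))).differentiableWithinAt

/-- The derivative of a holomorphic map on an open subset of a finite-dimensional space is
holomorphic. -/
theorem DifferentiableOn.fderiv_complex [FiniteDimensional ℂ E] [CompleteSpace G] {u : E → G}
    {U : Set E} (hU : IsOpen U) (hu : DifferentiableOn ℂ u U) :
    DifferentiableOn ℂ (fderiv ℂ u) U := by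
  let b := Module.finBasis ℂ E
  have hrepr : fderiv ℂ u = fun x => ∑ i,
      ContinuousLinearMap.smulRightL ℂ E G (LinearMap.toContinuousLinearMap (b.coord i))
        (fderiv ℂ u x (b i)) := by
    funext x
    ext v
    conv_lhs => rw [← b.sum_repr v, map_sum]
    simp
  rw [hrepr]
  refine DifferentiableOn.fun_sum fun i _ => ?_
  exact (ContinuousLinearMap.differentiable _).comp_differentiableOn
    (hu.fderiv_apply_complex hU (b i))

/-- `u` is complex differentiable at all points near the origin. -/
def HolomorphicNearZero (u : E → G) : Prop :=
  ∀ᶠ x in 𝓝 (0 : E), DifferentiableAt ℂ u x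

protected theorem HolomorphicNearZero.fderiv [FiniteDimensional ℂ E] [CompleteSpace G] {u : E → G}
    (hu : HolomorphicNearZero u) : HolomorphicNearZero (fderiv ℂ u) := by
  obtain ⟨U, hU, hUo, h0⟩ := _root_.eventually_nhds_iff.1 hu
  have hd := DifferentiableOn.fderiv_complex hUo
    (fun x hx => (hU x hx).differentiableWithinAt : DifferentiableOn ℂ u U)
  filter_upwards [hUo.mem_nhds h0] with x hx using hd.differentiableAt (hUo.mem_nhds hx)

theorem HolomorphicNearZero.isBigO_fderiv {u : E → G} (hu : HolomorphicNearZero u) {k : ℕ}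
    (hk : u =O[𝓝 0] fun x => ‖x‖ ^ (k + 1)) : fderiv ℂ u =O[𝓝 0] fun x => ‖x‖ ^ k := by
  rcases Nat.eq_zero_or_pos k with rfl | hkpos
  · obtain ⟨r, hr, h⟩ := Metric.eventually_nhds_iff_ball.1 (Filter.Eventually.and hu
      ((hk.trans_tendsto (Continuous.tendsto' (by fun_prop) _ _ (by simp))).norm.eventually
        (gt_mem_nhds (show ‖(0 : G)‖ < 1 by simp))))
    refine IsBigO.of_bound (2 * 1 / (r / 2)) ?_
    filter_upwards [ball_mem_nhds (0 : E) (half_pos hr)] with x hx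
    have hsub : ball x (r / 2) ⊆ ball 0 r := ball_subset_ball' (by rw [mem_ball] at hx; linarith)
    simpa using norm_fderiv_le_of_norm_le_on_ball (half_pos hr)
      (fun z hz => (h z (hsub hz)).1.differentiableWithinAt) (fun z hz => (h z (hsub hz)).2.le)
  · obtain ⟨C, hC0, hC⟩ := hk.exists_pos
    obtain ⟨r, hr, h⟩ := Metric.eventually_nhds_iff_ball.1 (Filter.Eventually.and hu hC.bound)
    have hderiv0 : HasFDerivAt u (0 : E →L[ℂ] G) 0 :=
      IsBigO.hasFDerivAt (by simpa using hk) (by omega)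
    refine IsBigO.of_bound (2 * C * 2 ^ (k + 1)) ?_
    filter_upwards [ball_mem_nhds (0 : E) (half_pos hr)] with x hx
    rcases eq_or_ne x 0 with rfl | hx0
    · simp [hderiv0.fderiv, hkpos.ne']
    · have hxpos : 0 < ‖x‖ := norm_pos_iff.2 hx0
      have hxr : ‖x‖ < r / 2 := by simpa using hx
      have hsub : ball x ‖x‖ ⊆ ball 0 r := ball_subset_ball' (by simp; linarith)
      have := norm_fderiv_le_of_norm_le_on_ball (u := u) (M := C * (2 * ‖x‖) ^ (k + 1)) hxpos
        (fun z hz => (h z (hsub hz)).1.differentiableWithinAt) (fun z hz => by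
          refine (h z (hsub hz)).2.trans ?_
          have hz2 : ‖z‖ ≤ 2 * ‖x‖ := by
            have h1 := norm_sub_norm_le z x
            have h2 : ‖z - x‖ < ‖x‖ := by simpa [dist_eq_norm] using hz
            linarith
          rw [norm_pow, norm_norm]
          gcongr)
      refine this.trans_eq ?_
      simp only [norm_pow, norm_norm]
      field_simp
      ring

/-- The leading homogeneous term of a holomorphic map vanishing to order `k` at the origin. -/
theorem HolomorphicNearZero.exists_multilinear_leading_term
    {E : Type} [NormedAddCommGroup E] [NormedSpace ℂ E]
    [FiniteDimensional ℂ E] (k : ℕ) :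
    ∀ {G : Type} [NormedAddCommGroup G] [NormedSpace ℂ G] [CompleteSpace G] {u : E → G},
      HolomorphicNearZero u → u =O[𝓝 0] (fun x => ‖x‖ ^ k) →
      ∃ m : E [×k]→L[ℂ] G, (fun x => u x - m fun _ => x) =O[𝓝 0] fun x => ‖x‖ ^ (k + 1) := by
  induction k with
  | zero =>
    intro G _ _ _ u hu _
    refine ⟨ContinuousMultilinearMap.uncurry0 ℂ E (u 0), ?_⟩
    simpa using hu.self_of_nhds.hasFDerivAt.isBigO_sub.norm_right
  | succ k ih =>
    intro G _ _ _ u hu huk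
    obtain ⟨m', hm'⟩ := ih hu.fderiv (hu.isBigO_fderiv huk)
    refine ⟨((k : ℂ) + 1)⁻¹ • m'.uncurryRight, ?_⟩
    obtain ⟨C, hC0, hC⟩ := hm'.exists_pos
    obtain ⟨r, hr, h⟩ := Metric.eventually_nhds_iff_ball.1 (Filter.Eventually.and hu hC.bound)
    have hu0 : u 0 = 0 := by
      simpa using huk.eq_zero_imp.self_of_nhds
    refine IsBigO.of_bound C ?_
    filter_upwards [ball_mem_nhds (0 : E) hr] with x hx
    have hxr : ‖x‖ < r := by simpa using hx
    let φ : ℝ → G := fun t =>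
      u ((t : ℂ) • x) - (((k : ℂ) + 1)⁻¹ * (t : ℂ) ^ (k + 1)) • m' (fun _ => x) x
    have hmem : ∀ t ∈ Set.Icc (0 : ℝ) 1, (t : ℂ) • x ∈ ball (0 : E) r := fun t ht => by
      have : ‖(t : ℂ) • x‖ ≤ ‖x‖ := by
        rw [norm_smul, Complex.norm_real, Real.norm_of_nonneg ht.1]
        exact mul_le_of_le_one_left (norm_nonneg _) ht.2
      simpa using this.trans_lt hxr
    have hφ : ∀ t ∈ Set.Icc (0 : ℝ) 1, HasDerivWithinAt φ
        (fderiv ℂ u ((t : ℂ) • x) x - (t : ℂ) ^ k • m' (fun _ => x) x) (Set.Icc 0 1) t := by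
      intro t ht
      have h1 : HasDerivAt (fun s : ℝ => (s : ℂ)) 1 t := Complex.ofRealCLM.hasDerivAt
      have h2 : HasDerivAt (fun s : ℂ => u (s • x)) (fderiv ℂ u ((t : ℂ) • x) x) (t : ℂ) := by
        have := (h _ (hmem t ht)).1.hasFDerivAt.comp_hasDerivAt (t : ℂ)
          (f := fun s : ℂ => s • x) (f' := x) (by simpa using (hasDerivAt_id (t : ℂ)).smul_const x)
        exact this
      have h3 : HasDerivAt (fun s : ℂ => (((k : ℂ) + 1)⁻¹ * s ^ (k + 1)) • m' (fun _ => x) x)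
          ((t : ℂ) ^ k • m' (fun _ => x) x) (t : ℂ) := by
        have h4 := ((hasDerivAt_pow (k + 1) (t : ℂ)).const_mul ((k : ℂ) + 1)⁻¹).smul_const
          (m' (fun _ => x) x)
        convert h4 using 2
        have : (k : ℂ) + 1 ≠ 0 := by exact_mod_cast k.succ_ne_zero
        push_cast
        field_simp
      have h5 := (h2.sub h3).scomp t h1
      rw [one_smul] at h5
      exact h5.hasDerivWithinAt
    have hbound : ∀ t ∈ Set.Ico (0 : ℝ) 1,
        ‖fderiv ℂ u ((t : ℂ) • x) x - (t : ℂ) ^ k • m' (fun _ => x) x‖ ≤ C * ‖x‖ ^ (k + 1 + 1) := by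
      intro t ht
      have h1 := (h _ (hmem t ⟨ht.1, ht.2.le⟩)).2
      have h2 : m' (fun _ => (t : ℂ) • x) = (t : ℂ) ^ k • m' (fun _ => x) := by
        simpa using m'.map_smul_univ (fun _ => (t : ℂ)) (fun _ => x)
      rw [h2] at h1
      have h3 := ContinuousLinearMap.le_of_opNorm_le _ h1 x
      refine h3.trans ?_
      have h4 : ‖(t : ℂ) • x‖ ≤ ‖x‖ := by
        rw [norm_smul, Complex.norm_real, Real.norm_of_nonneg ht.1]
        exact mul_le_of_le_one_left (norm_nonneg _) ht.2.le
      rw [pow_succ _ (k + 1), ← mul_assoc, norm_pow, norm_norm]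
      gcongr
    have := norm_image_sub_le_of_norm_deriv_le_segment' hφ hbound 1 (by simp)
    simpa [φ, hu0, ContinuousMultilinearMap.uncurryRight_apply, Fin.init_def] using this

end Holomorphic

section LinearFlow

variable {E : Type*} [NormedAddCommGroup E] [NormedSpace ℂ E]

theorem exp_smul_apply_eq_of_pow_apply_eq_zero [CompleteSpace E] (B : E →L[ℂ] E) {v : E} {k : ℕ}
    (hk : (B ^ k) v = 0) (t : ℝ) :
    NormedSpace.exp (t • B) v =
      ∑ j ∈ Finset.range k, (((j.factorial : ℂ)⁻¹ * (t : ℂ) ^ j) • (B ^ j) v) := by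
  have h1 := (ContinuousLinearMap.apply ℂ E v).hasSum
    (NormedSpace.exp_series_hasSum_exp' (𝕂 := ℂ) (t • B))
  refine h1.unique ?_
  have h2 : ∀ j, (ContinuousLinearMap.apply ℂ E v) ((j.factorial : ℂ)⁻¹ • (t • B) ^ j) =
      ((j.factorial : ℂ)⁻¹ * (t : ℂ) ^ j) • (B ^ j) v := by
    intro j
    rw [← Complex.coe_smul, _root_.smul_pow]
    simp [mul_smul]
  simp_rw [h2]
  refine hasSum_sum_of_ne_finset_zero fun j hj => ?_
  obtain ⟨i, rfl⟩ := Nat.exists_eq_add_of_le (not_lt.1 fun h => hj (Finset.mem_range.2 h))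
  have h3 : (B ^ (k + i)) v = (B ^ i) ((B ^ k) v) := by rw [add_comm, pow_add B]; rfl
  rw [h3, hk, map_zero, smul_zero]

/-- The linear flow grows at most at any exponential rate exceeding the real parts of all
eigenvalues. -/
theorem exists_norm_exp_smul_le [FiniteDimensional ℂ E] (A : E →L[ℂ] E) (a : ℝ)
    (hA : ∀ μ, Module.End.HasEigenvalue (A : E →ₗ[ℂ] E) μ → μ.re < a) :
    ∃ C > 0, ∀ t : ℝ, 0 ≤ t → ‖NormedSpace.exp (t • A)‖ ≤ C * Real.exp (a * t) := by
  have : CompleteSpace E := FiniteDimensional.complete ℂ E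
  have hpt : ∀ v : E, ∃ C, ∀ t : ℝ, 0 ≤ t → ‖NormedSpace.exp (t • A) v‖ ≤ C * Real.exp (a * t) := by
    intro v
    have hv : v ∈ ⨆ μ : ℂ, Module.End.maxGenEigenspace (A : E →ₗ[ℂ] E) μ := by
      rw [Module.End.iSup_maxGenEigenspace_eq_top]
      trivial
    induction hv using Submodule.iSup_induction' with
    | zero => exact ⟨0, by simp⟩
    | add v w _ _ ihv ihw =>
      obtain ⟨C, hC⟩ := ihv
      obtain ⟨D, hD⟩ := ihw
      refine ⟨C + D, fun t ht => ?_⟩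
      rw [map_add, add_mul]
      exact (norm_add_le _ _).trans (add_le_add (hC t ht) (hD t ht))
    | mem μ v hv =>
      rcases eq_or_ne v 0 with rfl | hv0
      · exact ⟨0, by simp⟩
      obtain ⟨k, hk⟩ := (Module.End.mem_maxGenEigenspace _ _ _).1 hv
      have hμ : μ.re < a := by
        refine hA μ (Module.End.hasEigenvalue_of_hasGenEigenvalue (k := k) fun h => hv0 ?_)
        have hmem : v ∈ Module.End.genEigenspace (A : E →ₗ[ℂ] E) μ k :=
          Module.End.mem_genEigenspace_nat.2 hk
        rwa [h, Submodule.mem_bot] at hmem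
      let B : E →L[ℂ] E := A - μ • 1
      have hB : ((B ^ k : E →L[ℂ] E)) v = 0 := by
        have h1 : ((B ^ k : E →L[ℂ] E) : E →ₗ[ℂ] E) = ((A : E →ₗ[ℂ] E) - μ • 1) ^ k := by
          ext w
          simp [B, Module.End.pow_apply]
        rw [← ContinuousLinearMap.coe_coe, h1, hk]
      set ε := a - μ.re
      have hε : 0 < ε := sub_pos.2 hμ
      refine ⟨∑ j ∈ Finset.range k, (ε ^ j)⁻¹ * ‖(B ^ j) v‖, fun t ht => ?_⟩
      have hsplit : t • A = algebraMap ℂ (E →L[ℂ] E) (t * μ) + t • B := by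
        ext w
        simp [B, Algebra.algebraMap_eq_smul_one, mul_smul, smul_sub]
      have hexp : NormedSpace.exp (t • A) v = Complex.exp (t * μ) • NormedSpace.exp (t • B) v := by
        let _ : NormedAlgebra ℚ (E →L[ℂ] E) := NormedAlgebra.restrictScalars ℚ ℂ _
        rw [hsplit, NormedSpace.exp_add_of_commute (Algebra.commutes _ _),
          ← NormedSpace.algebraMap_exp_comm, ← Complex.exp_eq_exp_ℂ,
          Algebra.algebraMap_eq_smul_one, smul_mul_assoc, one_mul]
        rfl
      rw [hexp, exp_smul_apply_eq_of_pow_apply_eq_zero B hB, norm_smul, Complex.norm_exp]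
      have hre : ((t : ℂ) * μ).re = (a - ε) * t := by simp [ε, mul_comm]
      have hsum : ‖∑ j ∈ Finset.range k, (((j.factorial : ℂ)⁻¹ * (t : ℂ) ^ j) • (B ^ j) v)‖ ≤
          (∑ j ∈ Finset.range k, (ε ^ j)⁻¹ * ‖(B ^ j) v‖) * Real.exp (ε * t) := by
        rw [Finset.sum_mul]
        refine norm_sum_le_of_le _ fun j _ => ?_
        have h1 := Real.pow_div_factorial_le_exp (ε * t) (by positivity) j
        rw [norm_smul, norm_mul, norm_inv, norm_pow, Complex.norm_natCast, Complex.norm_real,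
          Real.norm_of_nonneg ht, mul_right_comm (ε ^ j)⁻¹]
        refine mul_le_mul_of_nonneg_right ?_ (norm_nonneg ((B ^ j) v))
        rw [mul_pow] at h1
        rw [inv_mul_eq_div, inv_mul_eq_div, le_div_iff₀ (by positivity)]
        exact (le_of_eq (by ring)).trans h1
      rw [hre]
      refine (mul_le_mul_of_nonneg_left hsum (Real.exp_pos _).le).trans_eq ?_
      rw [mul_left_comm, ← Real.exp_add]
      ring_nf
  obtain ⟨C, hC⟩ := banach_steinhaus
    (g := fun t : Set.Ici (0 : ℝ) => (Real.exp (-(a * t)) : ℂ) • NormedSpace.exp ((t : ℝ) • A))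
    (fun v => by
      obtain ⟨C, hC⟩ := hpt v
      refine ⟨C, fun t => ?_⟩
      rw [smul_apply, norm_smul, Complex.norm_real,
        Real.norm_of_nonneg (Real.exp_pos _).le, Real.exp_neg,
        inv_mul_le_iff₀ (Real.exp_pos _), mul_comm]
      exact hC t t.2)
  refine ⟨max C 1, by positivity, fun t ht => ?_⟩
  have := hC ⟨t, ht⟩
  rw [norm_smul, Complex.norm_real, Real.norm_of_nonneg (Real.exp_pos _).le, Real.exp_neg,
    inv_mul_le_iff₀ (Real.exp_pos _)] at this
  refine this.trans ?_
  rw [mul_comm]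
  gcongr
  exact le_max_left _ _

theorem norm_le_of_hasEigenvalue {A : E →L[ℂ] E} {μ : ℂ}
    (hμ : Module.End.HasEigenvalue (A : E →ₗ[ℂ] E) μ) : ‖μ‖ ≤ ‖A‖ := by
  obtain ⟨v, hv⟩ := hμ.exists_hasEigenvector
  have h := A.le_opNorm v
  have h1 : A v = μ • v := hv.apply_eq_smul
  rw [h1, norm_smul] at h
  exact le_of_mul_le_mul_right h (norm_pos_iff.2 hv.2)

theorem exists_norm_exp_neg_smul_le [FiniteDimensional ℂ E] (A : E →L[ℂ] E) :
    ∃ C > 0, ∃ b, ∀ t : ℝ, 0 ≤ t → ‖NormedSpace.exp (-t • A)‖ ≤ C * Real.exp (b * t) := by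
  obtain ⟨C, hC, h⟩ := exists_norm_exp_smul_le (-A) (‖-A‖ + 1) fun μ hμ =>
    lt_of_le_of_lt ((Complex.re_le_norm μ).trans (norm_le_of_hasEigenvalue hμ)) (lt_add_one _)
  exact ⟨C, hC, _, fun t ht => by simpa using h t ht⟩

end LinearFlow

section HomologicalOperator

open Module

/-- Commuting endomorphisms have a common eigenvector in any nonzero invariant subspace. -/
theorem exists_common_eigenvector {K M ι : Type*} [Field K] [IsAlgClosed K] [AddCommGroup M]
    [Module K M] [FiniteDimensional K M] (f : ι → End K M) (hf : ∀ i j, Commute (f i) (f j))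
    (s : Finset ι) : ∀ W : Submodule K M, W ≠ ⊥ → (∀ i, ∀ w ∈ W, f i w ∈ W) →
      ∃ w ∈ W, w ≠ 0 ∧ ∀ i ∈ s, ∃ μ : K, f i w = μ • w := by
  classical
  induction s using Finset.induction_on with
  | empty =>
    intro W hW _
    obtain ⟨w, hw, hw0⟩ := W.ne_bot_iff.1 hW
    exact ⟨w, hw, hw0, by simp⟩
  | insert i s _ ih =>
    intro W hW hinv
    have : Nontrivial W := Submodule.nontrivial_iff_ne_bot.2 hW
    obtain ⟨μ, hμ⟩ := End.exists_eigenvalue ((f i).restrict (hinv i))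
    obtain ⟨v, hv⟩ := hμ.exists_hasEigenvector
    have hv1 : f i v = μ • (v : M) := congrArg Subtype.val hv.apply_eq_smul
    obtain ⟨w, hw, hw0, hws⟩ := ih (W ⊓ End.eigenspace (f i) μ)
      ((Submodule.ne_bot_iff _).2 ⟨v, ⟨v.2, End.mem_eigenspace_iff.2 hv1⟩, by simpa using hv.2⟩)
      (fun j w hw => ⟨hinv j w hw.1, by
        have h1 := End.mem_eigenspace_iff.1 hw.2
        have h2 : f i (f j w) = f j (f i w) := LinearMap.congr_fun (hf i j).eq w
        exact End.mem_eigenspace_iff.2 (by rw [h2, h1, map_smul])⟩)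
    refine ⟨w, hw.1, hw0, fun j hj => ?_⟩
    rcases Finset.mem_insert.1 hj with rfl | hj
    · exact ⟨μ, End.mem_eigenspace_iff.1 hw.2⟩
    · exact hws j hj

variable {E : Type*} [NormedAddCommGroup E] [NormedSpace ℂ E] {k : ℕ}

/-- Precomposition of a multilinear map with `A` in the `i`-th variable (for `some i`),
or postcomposition with `A` (for `none`). -/
noncomputable def compAt (A : E →L[ℂ] E) : Option (Fin k) → End ℂ (E [×k]→L[ℂ] E)
  | none => (ContinuousLinearMap.compContinuousMultilinearMapL ℂ (fun _ : Fin k => E) E E A :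
      (E [×k]→L[ℂ] E) →L[ℂ] (E [×k]→L[ℂ] E))
  | some i => (ContinuousMultilinearMap.compContinuousLinearMapL
      (Function.update (fun _ : Fin k => ContinuousLinearMap.id ℂ E) i A) :
      (E [×k]→L[ℂ] E) →L[ℂ] (E [×k]→L[ℂ] E))

theorem compAt_none_apply (A : E →L[ℂ] E) (m : E [×k]→L[ℂ] E) (x : Fin k → E) :
    compAt A none m x = A (m x) := rfl

theorem compAt_some_apply (A : E →L[ℂ] E) (i : Fin k) (m : E [×k]→L[ℂ] E) (x : Fin k → E) :
    compAt A (some i) m x = m (Function.update x i (A (x i))) := by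
  change m (fun j => Function.update (fun _ : Fin k => ContinuousLinearMap.id ℂ E) i A j (x j)) = _
  congr 1
  ext j
  rcases eq_or_ne j i with rfl | h <;> simp [*]

theorem commute_compAt (A : E →L[ℂ] E) (i j : Option (Fin k)) :
    Commute (compAt A i) (compAt A j) := by
  refine LinearMap.ext fun m => ContinuousMultilinearMap.ext fun x => ?_
  simp only [Module.End.mul_apply]
  rcases i with - | i <;> rcases j with - | j <;>
    simp only [compAt_none_apply, compAt_some_apply]
  rcases eq_or_ne i j with rfl | h
  · rfl
  · rw [Function.update_of_ne h.symm, Function.update_of_ne h, Function.update_comm h]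

/-- The homological operator `m ↦ ∑ᵢ m(…, A xᵢ, …) - A m(x₁, …, xₖ)` is surjective
in the absence of resonances. -/
theorem homologicalOperator_surjective [FiniteDimensional ℂ E] (A : E →L[ℂ] E)
    (hA : ∀ (μ : Fin k → ℂ) (ν : ℂ), (∀ i, End.HasEigenvalue (A : E →ₗ[ℂ] E) (μ i)) →
      End.HasEigenvalue (A : E →ₗ[ℂ] E) ν → ∑ i, μ i ≠ ν) :
    Function.Surjective
      ⇑(∑ i, compAt A (some i) - compAt A none : End ℂ (E [×k]→L[ℂ] E)) := by
  have : FiniteDimensional ℂ (E [×k]→L[ℂ] E) :=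
    FiniteDimensional.of_injective
      (ContinuousMultilinearMap.toMultilinearMapLinear (R' := ℂ) (A := ℂ))
      ContinuousMultilinearMap.toMultilinearMap_injective
  rw [← LinearMap.injective_iff_surjective, ← LinearMap.ker_eq_bot]
  by_contra hker
  obtain ⟨m, hm, hm0, heig⟩ := exists_common_eigenvector (compAt A) (commute_compAt A)
    Finset.univ _ hker (fun j m hm => by
      have hcomm : Commute (∑ i, compAt A (some i) - compAt A none) (compAt A j) :=
        (Commute.sum_left _ _ _ fun i _ => commute_compAt A _ _).sub_left (commute_compAt A _ _)
      have h2 := LinearMap.congr_fun hcomm.eq m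
      rw [Module.End.mul_apply, Module.End.mul_apply, LinearMap.mem_ker.1 hm, map_zero] at h2
      exact LinearMap.mem_ker.2 h2)
  choose! χ hχ using heig
  obtain ⟨x, hx⟩ : ∃ x, m x ≠ 0 := by
    by_contra! h
    exact hm0 (ContinuousMultilinearMap.ext h)
  refine hA (fun i => χ (some i)) (χ none) (fun i => ?_) ?_ ?_
  · rw [End.hasEigenvalue_iff, End.eigenspace_def]
    intro hbot
    have hsurj := LinearMap.injective_iff_surjective.1 (LinearMap.ker_eq_bot.1 hbot)
    obtain ⟨y, hy⟩ := hsurj (x i)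
    have h1 := congrArg (fun m => m (Function.update x i y)) (hχ (some i) (Finset.mem_univ _))
    simp only [compAt_some_apply, Function.update_idem, Function.update_self,
      smul_apply] at h1
    have h2 : A y = x i + χ (some i) • y := by
      rw [← hy]
      simp
    rw [h2, m.map_update_add, m.map_update_smul, Function.update_eq_self, add_eq_right] at h1
    exact hx h1
  · have h1 := congrArg (fun m => m x) (hχ none (Finset.mem_univ _))
    exact End.hasEigenvalue_of_hasEigenvector ⟨End.mem_eigenspace_iff.2 h1, hx⟩
  · have h1 := LinearMap.mem_ker.1 hm
    simp only [LinearMap.sub_apply, LinearMap.sum_apply, hχ _ (Finset.mem_univ _),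
      ← Finset.sum_smul, ← sub_smul] at h1
    exact sub_eq_zero.1 ((smul_eq_zero.1 h1).resolve_right hm0)

end HomologicalOperator

section FormalStep

open Metric Topology

variable {E : Type} [NormedAddCommGroup E] [NormedSpace ℂ E]

/-- A holomorphic map vanishing to second order is Lipschitz on small balls with constant
proportional to the radius. -/
theorem HolomorphicNearZero.exists_lipschitz {f : E → E} (hf : HolomorphicNearZero f)
    (hf2 : f =O[𝓝 0] fun x => ‖x‖ ^ 2) :
    ∃ C > 0, ∃ r > 0, DifferentiableOn ℂ f (ball 0 r) ∧
      ∀ ρ < r, ∀ y ∈ closedBall 0 ρ, ∀ z ∈ closedBall 0 ρ,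
        ‖f y - f z‖ ≤ C * ρ * ‖y - z‖ := by
  obtain ⟨C, hC, hbound⟩ := (hf.isBigO_fderiv (k := 1) hf2).exists_pos
  obtain ⟨r, hr, h⟩ := Metric.eventually_nhds_iff_ball.1 (Filter.Eventually.and hf hbound.bound)
  refine ⟨C, hC, r, hr, fun x hx => (h x hx).1.differentiableWithinAt,
    fun ρ hρ y hy z hz => ?_⟩
  have hsub : closedBall (0 : E) ρ ⊆ ball 0 r := closedBall_subset_ball hρ
  refine (convex_closedBall (0 : E) ρ).norm_image_sub_le_of_norm_fderiv_le (𝕜 := ℂ)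
    (fun x hx => (h x (hsub hx)).1) (fun x hx => ?_) hz hy
  refine (h x (hsub hx)).2.trans ?_
  have : ‖x‖ ≤ ρ := by simpa using hx
  simpa using mul_le_mul_of_nonneg_left this hC.le

theorem isBigO_comp_add_sub {f p q : E → E} {k : ℕ} (hf : HolomorphicNearZero f)
    (hf2 : f =O[𝓝 0] fun x => ‖x‖ ^ 2) (hp : p =O[𝓝 0] fun x => ‖x‖ ^ 2)
    (hk : 1 ≤ k) (hq : q =O[𝓝 0] fun x => ‖x‖ ^ k) :
    (fun x => f (x + (p x + q x)) - f (x + p x)) =O[𝓝 0] fun x => ‖x‖ ^ (k + 1) := by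
  obtain ⟨C, hC, r, hr, -, hlip⟩ := hf.exists_lipschitz hf2
  obtain ⟨P, hP, hp⟩ := hp.exists_pos
  obtain ⟨Q, hQ, hq⟩ := hq.exists_pos
  have hsmall : ∀ᶠ x in 𝓝 (0 : E), (1 + P + Q) * ‖x‖ < r :=
    (Continuous.tendsto' (by fun_prop : Continuous fun x : E => (1 + P + Q) * ‖x‖) 0 0
      (by simp)).eventually (gt_mem_nhds hr)
  refine IsBigO.of_bound (C * (1 + P + Q) * Q) ?_
  filter_upwards [hp.bound, hq.bound, hsmall, ball_mem_nhds (0 : E) one_pos] with x hpx hqx hx hx1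
  have hx1 : ‖x‖ ≤ 1 := by simpa using (mem_ball_zero_iff.1 hx1).le
  simp only [norm_pow, norm_norm] at hpx hqx ⊢
  have hp1 : ‖p x‖ ≤ P * ‖x‖ := hpx.trans <| mul_le_mul_of_nonneg_left
    (pow_le_of_le_one (norm_nonneg _) hx1 two_ne_zero) hP.le
  have hq1 : ‖q x‖ ≤ Q * ‖x‖ := hqx.trans <| mul_le_mul_of_nonneg_left
    (pow_le_of_le_one (norm_nonneg _) hx1 (by omega)) hQ.le
  have h1 := norm_add_le x (p x)
  have h2 := norm_add_le (x + p x) (q x)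
  have hQx : 0 ≤ Q * ‖x‖ := by positivity
  have h := hlip _ hx (x + (p x + q x)) (by rw [mem_closedBall_zero_iff, ← add_assoc]; linarith)
    (x + p x) (by rw [mem_closedBall_zero_iff]; linarith)
  refine h.trans ?_
  rw [add_sub_add_left_eq_sub, add_sub_cancel_left]
  calc _ ≤ C * ((1 + P + Q) * ‖x‖) * (Q * ‖x‖ ^ k) := by gcongr
    _ = _ := by ring

theorem HolomorphicNearZero.comp_id_add {f p : E → E} (hf : HolomorphicNearZero f)
    (hp : HolomorphicNearZero p) (hp2 : p =O[𝓝 0] fun x => ‖x‖ ^ 2) :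
    HolomorphicNearZero fun x => f (x + p x) := by
  have hp0 : Tendsto p (𝓝 0) (𝓝 0) :=
    hp2.trans_tendsto (Continuous.tendsto' (by fun_prop) _ _ (by simp))
  have ht : Tendsto (fun x => x + p x) (𝓝 0) (𝓝 0) := by
    simpa using tendsto_id.add hp0
  filter_upwards [ht.eventually hf, hp] with x hx hpx
  exact hx.comp x (differentiableAt_id.add hpx)

/-- The defect in the conjugacy equation for the coordinate change `x ↦ x + p x` between
the linear field `A` and the field `A + f`. -/
noncomputable def conjugacyDefect (A : E →L[ℂ] E) (f p : E → E) (x : E) : E :=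
  f (x + p x) - (fderiv ℂ p x (A x) - A (p x))

theorem HolomorphicNearZero.conjugacyDefect [FiniteDimensional ℂ E] {A : E →L[ℂ] E} {f p : E → E}
    (hf : HolomorphicNearZero f) (hp : HolomorphicNearZero p)
    (hp2 : p =O[𝓝 0] fun x => ‖x‖ ^ 2) : HolomorphicNearZero (conjugacyDefect A f p) := by
  have : CompleteSpace E := FiniteDimensional.complete ℂ E
  filter_upwards [hf.comp_id_add hp hp2, hp, hp.fderiv] with x h1 h2 h3
  exact h1.sub ((h3.clm_apply A.differentiableAt).sub (A.differentiableAt.comp x h2))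

theorem hasFDerivAt_multilinear_diagonal {k : ℕ} (m : E [×k]→L[ℂ] E) (x : E) :
    HasFDerivAt (fun x => m fun _ => x) (∑ i, m.toContinuousLinearMap (fun _ => x) i) x := by
  simpa using HasFDerivAt.multilinear_comp (f := m) (g := fun _ x => x)
    (fun _ => hasFDerivAt_id x)

/-- In the absence of resonances the conjugacy equation can be solved to any finite order. -/
theorem exists_conjugacyDefect_isBigO [FiniteDimensional ℂ E] {A : E →L[ℂ] E} {f : E → E}
    (hA : ∀ k, 2 ≤ k → ∀ (μ : Fin k → ℂ) (ν : ℂ),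
      (∀ i, Module.End.HasEigenvalue (A : E →ₗ[ℂ] E) (μ i)) →
      Module.End.HasEigenvalue (A : E →ₗ[ℂ] E) ν → ∑ i, μ i ≠ ν)
    (hf : HolomorphicNearZero f) (hf2 : f =O[𝓝 0] fun x => ‖x‖ ^ 2) {k : ℕ} (hk : 2 ≤ k) :
    ∃ p : E → E, HolomorphicNearZero p ∧ (p =O[𝓝 0] fun x => ‖x‖ ^ 2) ∧
      conjugacyDefect A f p =O[𝓝 0] fun x => ‖x‖ ^ k := by
  have : CompleteSpace E := FiniteDimensional.complete ℂ E
  induction k, hk using Nat.le_induction with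
  | base =>
    refine ⟨fun _ => 0, .of_forall fun x => by fun_prop, isBigO_zero _ _, ?_⟩
    exact hf2.congr_left fun x => by simp [conjugacyDefect]
  | succ k hk ih =>
    obtain ⟨p, hp, hp2, hR⟩ := ih
    obtain ⟨m, hm⟩ := (hf.conjugacyDefect hp hp2).exists_multilinear_leading_term k hR
    obtain ⟨s, rfl⟩ := homologicalOperator_surjective A (hA k hk) m
    let q : E → E := fun x => s fun _ => x
    have hq : q =O[𝓝 0] fun x => ‖x‖ ^ k := IsBigO.of_bound ‖s‖ <| .of_forall fun x => by
      simpa using s.le_opNorm fun _ => x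
    have hq2 : q =O[𝓝 0] fun x => ‖x‖ ^ 2 := hq.trans <| by
      refine IsBigO.of_bound 1 ?_
      filter_upwards [ball_mem_nhds (0 : E) one_pos] with x hx
      simpa using pow_le_pow_of_le_one (norm_nonneg x) (mem_ball_zero_iff.1 hx).le hk
    have hqd (x : E) : HasFDerivAt q (∑ i, s.toContinuousLinearMap (fun _ => x) i) x :=
      hasFDerivAt_multilinear_diagonal s x
    refine ⟨fun x => p x + q x, ?_, hp2.add hq2, ?_⟩
    · filter_upwards [hp] with x hx using hx.add (hqd x).differentiableAt
    · refine ((isBigO_comp_add_sub hf hf2 hp2 (by omega) hq).add hm).congr' ?_ .rfl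
      filter_upwards [hp] with x hx
      have hqA : (∑ i, s.toContinuousLinearMap (fun _ => x) i) (A x) - A (q x) =
          (∑ i, compAt A (some i) - compAt A none : Module.End ℂ (E [×k]→L[ℂ] E)) s fun _ => x := by
        simp [compAt_some_apply, compAt_none_apply, q,
          ContinuousMultilinearMap.toContinuousLinearMap]
      rw [← hqA, conjugacyDefect, conjugacyDefect, (hx.hasFDerivAt.fun_add (hqd x)).fderiv, map_add]
      simp only [_root_.add_apply]
      abel

end FormalStep

section HomologicalEquation

open Metric Topology MeasureTheory

variable {E : Type} [NormedAddCommGroup E] [NormedSpace ℂ E]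

/-- The flow of the linear vector field `A`, in complex time. -/
noncomputable def linearFlow (A : E →L[ℂ] E) (z : ℂ) : E →L[ℂ] E := NormedSpace.exp (z • A)

@[simp] theorem linearFlow_zero (A : E →L[ℂ] E) : linearFlow A 0 = 1 := by
  simp [linearFlow]

theorem linearFlow_apply_comm (A : E →L[ℂ] E) (z : ℂ) (x : E) :
    linearFlow A z (A x) = A (linearFlow A z x) :=
  congrArg (fun B : E →L[ℂ] E => B x) ((Commute.refl A).smul_left z).exp_left.eq

variable {A : E →L[ℂ] E} {a b C D M : ℝ} {N : ℕ} {U : Set E} {u v : E → E}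

/-- Growth rates for the linear flow: it contracts forward in time like `e^{-at}` and expands
backward in time at most like `e^{bt}`, where `b` is dominated by `N` times `a`. -/
structure FlowBounds (A : E →L[ℂ] E) (a b C D : ℝ) (N : ℕ) : Prop where
  pos_left : 0 < C
  pos_right : 0 < D
  norm_le : ∀ t : ℝ, 0 ≤ t → ‖linearFlow A t‖ ≤ C * Real.exp (-a * t)
  norm_neg_le : ∀ t : ℝ, 0 ≤ t → ‖linearFlow A (-t)‖ ≤ D * Real.exp (b * t)
  lt : b < N * a

theorem FlowBounds.norm_pullback_le (h : FlowBounds A a b C D N) (hM : 0 ≤ M)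
    (hinv : ∀ t : ℝ, 0 ≤ t → Set.MapsTo (linearFlow A t) U U)
    (huM : ∀ x ∈ U, ‖u x‖ ≤ M * ‖x‖ ^ N) {x : E} (hx : x ∈ U) {t : ℝ} (ht : 0 ≤ t) :
    ‖linearFlow A (-t) (u (linearFlow A t x))‖ ≤
      D * C ^ N * M * ‖x‖ ^ N * Real.exp ((b - N * a) * t) := by
  have hC := h.pos_left
  have hD := h.pos_right
  calc _ ≤ ‖linearFlow A (-t)‖ * ‖u (linearFlow A t x)‖ := (linearFlow A (-t)).le_opNorm _
    _ ≤ (D * Real.exp (b * t)) * (M * (C * Real.exp (-a * t) * ‖x‖) ^ N) := by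
      refine mul_le_mul (h.norm_neg_le t ht) ((huM _ (hinv t ht hx)).trans ?_)
        (norm_nonneg _) (by positivity)
      gcongr
      exact (linearFlow A t).le_of_opNorm_le (h.norm_le t ht) x
    _ = D * C ^ N * M * ‖x‖ ^ N * (Real.exp (b * t) * Real.exp (-a * t) ^ N) := by
      rw [mul_pow, mul_pow]; ring
    _ = _ := by
      rw [← Real.exp_nat_mul, ← Real.exp_add]
      ring_nf

theorem FlowBounds.integrableOn_exp (h : FlowBounds A a b C D N) (c : ℝ) :
    IntegrableOn (fun t : ℝ => c * Real.exp ((b - N * a) * t)) (Set.Ioi 0) :=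
  (integrableOn_exp_mul_Ioi (sub_neg.2 h.lt) 0).const_mul c

/-- The solution `x ↦ -∫₀^∞ e^{-tA} u(e^{tA} x) dt` of the homological equation. -/
noncomputable def homologicalSolution (A : E →L[ℂ] E) (u : E → E) (x : E) : E :=
  -∫ t in Set.Ioi (0 : ℝ), linearFlow A (-t) (u (linearFlow A t x))

theorem FlowBounds.norm_homologicalSolution_le (h : FlowBounds A a b C D N) (hM : 0 ≤ M)
    (hinv : ∀ t : ℝ, 0 ≤ t → Set.MapsTo (linearFlow A t) U U)
    (huM : ∀ x ∈ U, ‖u x‖ ≤ M * ‖x‖ ^ N) {x : E} (hx : x ∈ U) :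
    ‖homologicalSolution A u x‖ ≤ D * C ^ N / (N * a - b) * M * ‖x‖ ^ N := by
  rw [homologicalSolution, norm_neg]
  refine (norm_integral_le_of_norm_le (h.integrableOn_exp (D * C ^ N * M * ‖x‖ ^ N)) ?_).trans_eq ?_
  · filter_upwards [ae_restrict_mem measurableSet_Ioi] with t ht
    exact h.norm_pullback_le hM hinv huM hx (Set.mem_Ioi.1 ht).le
  · have h1 : b - N * a < 0 := sub_neg.2 h.lt
    have h2 : N * a - b ≠ 0 := (sub_pos.2 h.lt).ne'
    rw [integral_const_mul, integral_exp_mul_Ioi h1, mul_zero, Real.exp_zero, neg_div,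
      ← div_neg, neg_sub]
    field_simp

variable [FiniteDimensional ℂ E]

theorem linearFlow_add_apply (A : E →L[ℂ] E) (z w : ℂ) (x : E) :
    linearFlow A (z + w) x = linearFlow A z (linearFlow A w x) := by
  have : CompleteSpace E := FiniteDimensional.complete ℂ E
  let _ : NormedAlgebra ℚ (E →L[ℂ] E) := NormedAlgebra.restrictScalars ℚ ℂ _
  rw [linearFlow, add_smul, NormedSpace.exp_add_of_commute
    (((Commute.refl A).smul_left z).smul_right w)]
  rfl

theorem hasDerivAt_linearFlow (A : E →L[ℂ] E) (z : ℂ) :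
    HasDerivAt (linearFlow A) (linearFlow A z * A) z :=
  have : CompleteSpace E := FiniteDimensional.complete ℂ E
  hasDerivAt_exp_smul_const A z

theorem continuous_linearFlow (A : E →L[ℂ] E) : Continuous (linearFlow A) :=
  continuous_iff_continuousAt.2 fun z => (hasDerivAt_linearFlow A z).continuousAt

theorem hasDerivAt_pullback {A : E →L[ℂ] E} {u : E → E} {x : E} {t : ℝ}
    (hu : DifferentiableAt ℂ u (linearFlow A t x)) :
    HasDerivAt (fun t : ℝ => linearFlow A (-t) (u (linearFlow A t x)))
      (linearFlow A (-t) (fderiv ℂ u (linearFlow A t x) (linearFlow A t (A x))) -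
        A (linearFlow A (-t) (u (linearFlow A t x)))) t := by
  have h1 : HasDerivAt (fun z : ℂ => linearFlow A (-z)) (-(linearFlow A (-t) * A)) (t : ℂ) := by
    have h := (hasDerivAt_linearFlow A (-t)).scomp (t : ℂ) (hasDerivAt_neg (t : ℂ))
    rw [neg_one_smul] at h
    exact h
  have h2 : HasDerivAt (fun z : ℂ => linearFlow A z x) (linearFlow A t (A x)) (t : ℂ) := by
    simpa using (hasDerivAt_linearFlow A t).clm_apply (hasDerivAt_const (t : ℂ) x)
  have h3 := (h1.clm_apply (hu.hasFDerivAt.comp_hasDerivAt (t : ℂ) h2)).scomp t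
    Complex.ofRealCLM.hasDerivAt
  refine h3.congr_deriv ?_
  rw [← linearFlow_apply_comm]
  simp [sub_eq_neg_add]

theorem continuousOn_pullback (hinv : ∀ t : ℝ, 0 ≤ t → Set.MapsTo (linearFlow A t) U U)
    (hu : ContinuousOn u U) {x : E} (hx : x ∈ U) :
    ContinuousOn (fun t : ℝ => linearFlow A (-t) (u (linearFlow A t x))) (Set.Ici 0) := by
  have h1 : Continuous fun t : ℝ => linearFlow A (-t) :=
    (continuous_linearFlow A).comp (by fun_prop)
  have h2 : Continuous fun t : ℝ => linearFlow A t x :=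
    ((continuous_linearFlow A).comp Complex.continuous_ofReal).clm_apply continuous_const
  exact h1.continuousOn.clm_apply (hu.comp h2.continuousOn fun t ht => hinv t ht hx)

theorem FlowBounds.integrableOn_pullback (h : FlowBounds A a b C D N) (hM : 0 ≤ M)
    (hinv : ∀ t : ℝ, 0 ≤ t → Set.MapsTo (linearFlow A t) U U) (hu : ContinuousOn u U)
    (huM : ∀ x ∈ U, ‖u x‖ ≤ M * ‖x‖ ^ N) {x : E} (hx : x ∈ U) :
    IntegrableOn (fun t : ℝ => linearFlow A (-t) (u (linearFlow A t x))) (Set.Ioi 0) := by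
  refine (h.integrableOn_exp (D * C ^ N * M * ‖x‖ ^ N)).mono'
    (((continuousOn_pullback hinv hu hx).mono Set.Ioi_subset_Ici_self).aestronglyMeasurable
      measurableSet_Ioi) ?_
  filter_upwards [ae_restrict_mem measurableSet_Ioi] with t ht
  exact h.norm_pullback_le hM hinv huM hx (Set.mem_Ioi.1 ht).le

theorem FlowBounds.homologicalSolution_sub (h : FlowBounds A a b C D N) (hM : 0 ≤ M)
    (hinv : ∀ t : ℝ, 0 ≤ t → Set.MapsTo (linearFlow A t) U U) (hu : ContinuousOn u U)
    (huM : ∀ x ∈ U, ‖u x‖ ≤ M * ‖x‖ ^ N) (hv : ContinuousOn v U)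
    (hvM : ∀ x ∈ U, ‖v x‖ ≤ M * ‖x‖ ^ N) {x : E} (hx : x ∈ U) :
    homologicalSolution A u x - homologicalSolution A v x =
      homologicalSolution A (fun y => u y - v y) x := by
  simp only [homologicalSolution, map_sub]
  rw [integral_sub (h.integrableOn_pullback hM hinv hu huM hx)
    (h.integrableOn_pullback hM hinv hv hvM hx)]
  abel

/-- `homologicalSolution A u` is holomorphic and solves `w'(x)(A x) = A (w x) + u x`. -/
theorem FlowBounds.exists_hasFDerivAt_homologicalSolution (h : FlowBounds A a b C D N)
    (hM : 0 ≤ M) (hU : IsOpen U) (hinv : ∀ t : ℝ, 0 ≤ t → Set.MapsTo (linearFlow A t) U U)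
    (hu : DifferentiableOn ℂ u U) (huM : ∀ x ∈ U, ‖u x‖ ≤ M * ‖x‖ ^ N) {x : E} (hx : x ∈ U) :
    ∃ L : E →L[ℂ] E, HasFDerivAt (homologicalSolution A u) L x ∧
      L (A x) = A (homologicalSolution A u x) + u x := by
  have : CompleteSpace E := FiniteDimensional.complete ℂ E
  have hC := h.pos_left
  have hD := h.pos_right
  obtain ⟨r, hr, hball⟩ := Metric.isOpen_iff.1 hU x hx
  set κ : ℝ := D * C ^ N * M * (‖x‖ + r) ^ N
  let G' : E → ℝ → E →L[ℂ] E := fun y t =>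
    linearFlow A (-t) ∘L fderiv ℂ u (linearFlow A t y) ∘L linearFlow A t
  have hG' : ∀ t : ℝ, 0 ≤ t → ∀ y ∈ U,
      HasFDerivAt (fun y => linearFlow A (-t) (u (linearFlow A t y))) (G' y t) y := by
    intro t ht y hy
    have hd := (hu.differentiableAt (hU.mem_nhds (hinv t ht hy))).hasFDerivAt
    exact (linearFlow A (-t)).hasFDerivAt.comp y (hd.comp y (linearFlow A t).hasFDerivAt)
  have hbound : ∀ t : ℝ, 0 ≤ t → ∀ y ∈ ball x (r / 2),
      ‖G' y t‖ ≤ 2 * κ / (r / 2) * Real.exp ((b - N * a) * t) := by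
    intro t ht y hy
    have hsub : ball y (r / 2) ⊆ ball x r :=
      ball_subset_ball' (by rw [mem_ball] at hy; linarith)
    rw [← (hG' t ht y (hball (hsub (mem_ball_self (half_pos hr))))).fderiv]
    refine (norm_fderiv_le_of_norm_le_on_ball (M := κ * Real.exp ((b - N * a) * t)) (half_pos hr)
      (fun z hz => (hG' t ht z (hball (hsub hz))).differentiableAt.differentiableWithinAt)
      fun z hz => ?_).trans_eq (by ring)
    refine (h.norm_pullback_le hM hinv huM (hball (hsub hz)) ht).trans ?_
    have hzn : ‖z‖ ≤ ‖x‖ + r := by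
      have h1 := norm_le_insert' z x
      have h2 : ‖z - x‖ < r := by simpa [dist_eq_norm] using hsub hz
      linarith
    exact mul_le_mul_of_nonneg_right (mul_le_mul_of_nonneg_left
      (pow_le_pow_left₀ (norm_nonneg z) hzn N) (by positivity)) (Real.exp_pos _).le
  have hmeas : AEStronglyMeasurable (G' x) (volume.restrict (Set.Ioi 0)) := by
    refine ContinuousOn.aestronglyMeasurable ?_ measurableSet_Ioi
    have h1 : Continuous fun t : ℝ => linearFlow A (-t) :=
      (continuous_linearFlow A).comp (by fun_prop)
    have h2 : Continuous fun t : ℝ => linearFlow A t :=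
      (continuous_linearFlow A).comp Complex.continuous_ofReal
    have h3 : ContinuousOn (fun t : ℝ => fderiv ℂ u (linearFlow A t x)) (Set.Ioi 0) :=
      (DifferentiableOn.fderiv_complex hU hu).continuousOn.comp
        (h2.clm_apply continuous_const).continuousOn fun t ht => hinv t (Set.mem_Ioi.1 ht).le hx
    exact h1.continuousOn.clm_comp (h3.clm_comp h2.continuousOn)
  have hIntDeriv : IntegrableOn (G' x) (Set.Ioi 0) := by
    refine (h.integrableOn_exp (2 * κ / (r / 2))).mono' hmeas ?_
    filter_upwards [ae_restrict_mem measurableSet_Ioi] with t ht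
    exact hbound t (Set.mem_Ioi.1 ht).le x (mem_ball_self (half_pos hr))
  have hGint := h.integrableOn_pullback hM hinv hu.continuousOn huM hx
  have hderiv : HasFDerivAt (fun y => ∫ t in Set.Ioi (0 : ℝ),
      linearFlow A (-t) (u (linearFlow A t y))) (∫ t in Set.Ioi (0 : ℝ), G' x t) x := by
    refine hasFDerivAt_integral_of_dominated_of_fderiv_le (ball_mem_nhds x (half_pos hr)) ?_ hGint
      hmeas ?_ (h.integrableOn_exp (2 * κ / (r / 2))) ?_
    · filter_upwards [hU.mem_nhds hx] with y hy
      exact (h.integrableOn_pullback hM hinv hu.continuousOn huM hy).aestronglyMeasurable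
    · filter_upwards [ae_restrict_mem measurableSet_Ioi] with t ht
      exact hbound t (Set.mem_Ioi.1 ht).le
    · filter_upwards [ae_restrict_mem measurableSet_Ioi] with t ht y hy
      exact hG' t (Set.mem_Ioi.1 ht).le y
        (hball (ball_subset_ball (by linarith) hy))
  refine ⟨_, hderiv.neg, ?_⟩
  have hlim : Tendsto (fun t : ℝ => linearFlow A (-t) (u (linearFlow A t x))) atTop (𝓝 0) := by
    refine squeeze_zero_norm' (a := fun t => D * C ^ N * M * ‖x‖ ^ N *
      Real.exp ((b - N * a) * t)) ?_ ?_
    · filter_upwards [eventually_ge_atTop (0 : ℝ)] with t ht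
      exact h.norm_pullback_le hM hinv huM hx ht
    · have h1 : Tendsto (fun t : ℝ => (b - N * a) * t) atTop atBot :=
        tendsto_id.const_mul_atTop_of_neg (sub_neg.2 h.lt)
      simpa using (Real.tendsto_exp_atBot.comp h1).const_mul (D * C ^ N * M * ‖x‖ ^ N)
  have hIntDeriv' : IntegrableOn (fun t : ℝ => linearFlow A (-t) (fderiv ℂ u (linearFlow A t x)
      (linearFlow A t (A x)))) (Set.Ioi 0) := hIntDeriv.apply_continuousLinearMap (A x)
  have hftc := integral_Ioi_of_hasDerivAt_of_tendsto
    (continuousOn_pullback hinv hu.continuousOn hx 0 Set.self_mem_Ici)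
    (fun t ht => hasDerivAt_pullback
      (hu.differentiableAt (hU.mem_nhds (hinv t (Set.mem_Ioi.1 ht).le hx))))
    (hIntDeriv'.sub (A.integrable_comp hGint)) hlim
  rw [integral_sub hIntDeriv' (A.integrable_comp hGint),
    A.integral_comp_comm hGint] at hftc
  rw [_root_.neg_apply, ContinuousLinearMap.integral_apply hIntDeriv, homologicalSolution, map_neg]
  simp only [Complex.ofReal_zero, neg_zero, linearFlow_zero, zero_sub] at hftc
  have hone : ∀ y : E, (1 : E →L[ℂ] E) y = y := fun _ => rfl
  rw [hone, hone] at hftc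
  change -(∫ t in Set.Ioi (0 : ℝ), linearFlow A (-t) (fderiv ℂ u (linearFlow A t x)
    (linearFlow A t (A x)))) = _
  rw [eq_add_of_sub_eq hftc]
  abel

end HomologicalEquation

section Picard

open Metric Topology

variable {E : Type} [NormedAddCommGroup E] [NormedSpace ℂ E]

/-- `g` is holomorphic on `U` and bounded by `B * ‖x‖ ^ N` there. -/
structure HolomorphicOfOrder (U : Set E) (B : ℝ) (N : ℕ) (g : E → E) : Prop where
  differentiableOn : DifferentiableOn ℂ g U
  norm_le : ∀ x ∈ U, ‖g x‖ ≤ B * ‖x‖ ^ N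

/-- The contraction principle for holomorphic maps vanishing to order `N` at the origin. -/
theorem exists_holomorphicOfOrder_fixedPoint [CompleteSpace E] {U : Set E} {B ρ : ℝ} {N : ℕ}
    (hU : IsOpen U) (hUρ : U ⊆ ball 0 ρ) (hB : 0 ≤ B) (T : (E → E) → E → E)
    (hT : ∀ g, HolomorphicOfOrder U B N g → HolomorphicOfOrder U B N (T g))
    (hcontr : ∀ g₁ g₂, HolomorphicOfOrder U B N g₁ → HolomorphicOfOrder U B N g₂ → ∀ δ, 0 ≤ δ →
      (∀ x ∈ U, ‖g₁ x - g₂ x‖ ≤ δ * ‖x‖ ^ N) →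
      ∀ x ∈ U, ‖T g₁ x - T g₂ x‖ ≤ δ / 2 * ‖x‖ ^ N) :
    ∃ g, HolomorphicOfOrder U B N g ∧ ∀ x ∈ U, T g x = g x := by
  let G : ℕ → E → E := fun n => T^[n] 0
  have hsucc : ∀ n, G (n + 1) = T (G n) := fun n => Function.iterate_succ_apply' T n 0
  have hG : ∀ n, HolomorphicOfOrder U B N (G n) := by
    intro n
    induction n with
    | zero => exact ⟨differentiableOn_const 0, fun x _ => by simp [G]; positivity⟩
    | succ n ih => exact hsucc n ▸ hT _ ih
  have hdist : ∀ n, ∀ x ∈ U, ‖G n x - G (n + 1) x‖ ≤ B * (1 / 2) ^ n * ‖x‖ ^ N := by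
    intro n
    induction n with
    | zero =>
      intro x hx
      simpa [G] using (hG 1).norm_le x hx
    | succ n ih =>
      intro x hx
      have h := hcontr _ _ (hG n) (hG (n + 1)) _ (by positivity) ih x hx
      rw [← hsucc, ← hsucc] at h
      exact h.trans_eq (by ring)
  have hdist' : ∀ x ∈ U, ∀ n, dist (G n x) (G (n + 1) x) ≤ B * ‖x‖ ^ N * (1 / 2) ^ n := by
    intro x hx n
    rw [dist_eq_norm]
    exact (hdist n x hx).trans_eq (by ring)
  have hlim : ∀ x, ∃ y, x ∈ U → Tendsto (fun n => G n x) atTop (𝓝 y) := by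
    intro x
    by_cases hx : x ∈ U
    · obtain ⟨y, hy⟩ := cauchySeq_tendsto_of_complete
        (cauchySeq_of_le_geometric (1 / 2) _ (by norm_num) (hdist' x hx))
      exact ⟨y, fun _ => hy⟩
    · exact ⟨0, fun h => absurd h hx⟩
  choose g hg using hlim
  have herr : ∀ n, ∀ x ∈ U, ‖G n x - g x‖ ≤ 2 * B * (1 / 2) ^ n * ‖x‖ ^ N := by
    intro n x hx
    rw [← dist_eq_norm]
    refine (dist_le_of_le_geometric_of_tendsto (1 / 2) _ (by norm_num) (hdist' x hx)
      (hg x hx) n).trans_eq ?_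
    ring
  have hzero : ∀ c : ℝ, Tendsto (fun n : ℕ => 2 * B * (1 / 2) ^ n * c) atTop (𝓝 0) := fun c => by
    simpa using ((tendsto_pow_atTop_nhds_zero_of_lt_one (r := (1 / 2 : ℝ)) (by norm_num)
      (by norm_num)).const_mul (2 * B)).mul_const c
  have hunif : TendstoUniformlyOn G g atTop U := by
    rw [Metric.tendstoUniformlyOn_iff]
    intro ε hε
    filter_upwards [(hzero (ρ ^ N)).eventually (gt_mem_nhds hε)] with n hn x hx
    rw [dist_comm, dist_eq_norm]
    refine ((herr n x hx).trans ?_).trans_lt hn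
    have : ‖x‖ ≤ ρ := (mem_ball_zero_iff.1 (hUρ hx)).le
    gcongr
  have hgord : HolomorphicOfOrder U B N g :=
    ⟨hunif.differentiableOn_complex hU fun n => (hG n).differentiableOn, fun x hx =>
      le_of_tendsto (hg x hx).norm (.of_forall fun n => (hG n).norm_le x hx)⟩
  refine ⟨g, hgord, fun x hx => tendsto_nhds_unique ?_ (hg x hx)⟩
  rw [← tendsto_add_atTop_iff_nat 1, tendsto_iff_norm_sub_tendsto_zero]
  refine squeeze_zero (fun _ => norm_nonneg _) (fun n => ?_) (hzero (‖x‖ ^ N / 2))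
  have h := hcontr _ _ (hG n) hgord _ (by positivity) (herr n) x hx
  rw [← hsucc] at h
  exact h.trans_eq (by ring)

variable [FiniteDimensional ℂ E] {A : E →L[ℂ] E} {a b C D : ℝ} {N : ℕ}

/-- A contracting linear flow has arbitrarily small open forward invariant neighborhoods of `0`. -/
theorem FlowBounds.exists_invariant_nhds (h : FlowBounds A a b C D N) (ha : 0 < a) {ρ : ℝ}
    (hρ : 0 < ρ) : ∃ U : Set E, IsOpen U ∧ 0 ∈ U ∧ U ⊆ ball 0 ρ ∧
      ∀ t : ℝ, 0 ≤ t → Set.MapsTo (linearFlow A t) U U := by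
  have hC := h.pos_left
  refine ⟨⋃ t : Set.Ici (0 : ℝ), linearFlow A (-(t : ℝ)) ⁻¹' ball 0 (ρ / C),
    isOpen_iUnion fun t => isOpen_ball.preimage (linearFlow A _).continuous,
    Set.mem_iUnion.2 ⟨⟨0, Set.self_mem_Ici⟩, ?_⟩, Set.iUnion_subset ?_, ?_⟩
  · simpa using div_pos hρ hC
  · rintro ⟨t, ht⟩ y hy
    have hy' : ‖linearFlow A (-t) y‖ < ρ / C := by simpa using hy
    have h1 : linearFlow A t (linearFlow A (-t) y) = y := by
      rw [← linearFlow_add_apply, add_neg_cancel, linearFlow_zero]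
      rfl
    rw [mem_ball_zero_iff, ← h1]
    have h2 : ‖linearFlow A t‖ ≤ C := (h.norm_le t ht).trans <| by
      have : Real.exp (-a * t) ≤ 1 := Real.exp_le_one_iff.2 (by nlinarith [Set.mem_Ici.1 ht])
      exact mul_le_of_le_one_right hC.le this
    calc _ ≤ C * ‖linearFlow A (-t) y‖ := (linearFlow A t).le_of_opNorm_le h2 _
      _ < C * (ρ / C) := by gcongr
      _ = ρ := by field_simp
  · intro s hs y hy
    obtain ⟨⟨t, ht⟩, hy⟩ := Set.mem_iUnion.1 hy
    refine Set.mem_iUnion.2 ⟨⟨s + t, add_nonneg hs ht⟩, ?_⟩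
    rw [Set.mem_preimage, ← linearFlow_add_apply]
    simpa using hy

/-- An approximate solution of the conjugacy equation of sufficiently high order can be
corrected to an exact one. -/
theorem FlowBounds.exists_conjugacyDefect_eq_zero (h : FlowBounds A a b C D N) (ha : 0 < a)
    (hN : 2 ≤ N) {f p : E → E} (hf : HolomorphicNearZero f) (hf2 : f =O[𝓝 0] fun x => ‖x‖ ^ 2)
    (hp : HolomorphicNearZero p) (hp2 : p =O[𝓝 0] fun x => ‖x‖ ^ 2)
    (hR : conjugacyDefect A f p =O[𝓝 0] fun x => ‖x‖ ^ N) :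
    ∃ w : E → E, HolomorphicNearZero w ∧ (w =O[𝓝 0] fun x => ‖x‖ ^ 2) ∧
      ∀ᶠ x in 𝓝 0, conjugacyDefect A f w x = 0 := by
  have : CompleteSpace E := FiniteDimensional.complete ℂ E
  obtain ⟨K, hK, r, hr, hfd, hlip⟩ := hf.exists_lipschitz hf2
  obtain ⟨M, hM, hR⟩ := hR.exists_pos
  have hp1 : ∀ᶠ x in 𝓝 0, ‖p x‖ ≤ 1 * ‖x‖ :=
    (hp2.trans_isLittleO (isLittleO_norm_pow_id one_lt_two)).def one_pos
  obtain ⟨r₁, hr₁, hnear⟩ := Metric.eventually_nhds_iff_ball.1 (Filter.Eventually.and hp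
    (hp1.and (Filter.Eventually.and (hf.conjugacyDefect (A := A) hp hp2) hR.bound)))
  have hC := h.pos_left
  have hD := h.pos_right
  have hgap : 0 < N * a - b := sub_pos.2 h.lt
  set c : ℝ := D * C ^ N / (N * a - b)
  have hc : 0 < c := by positivity
  set B : ℝ := 2 * c * M
  have hB : 0 < B := by positivity
  obtain ⟨ρ, hρr₁, hρr, hρc, hρB, hρ1, hρ⟩ : ∃ ρ : ℝ, ρ < r₁ ∧ 3 * ρ < r ∧
      c * (K * (3 * ρ)) < 1 / 2 ∧ B * ρ < 1 ∧ ρ < 1 ∧ 0 < ρ := by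
    have hsmall : ∀ φ : ℝ → ℝ, Continuous φ → φ 0 = 0 → ∀ ε > 0, ∀ᶠ ρ in 𝓝[>] (0 : ℝ), φ ρ < ε :=
      fun φ hφ h0 ε hε => ((hφ.tendsto' 0 0 h0).mono_left nhdsWithin_le_nhds).eventually
        (gt_mem_nhds hε)
    exact ((hsmall (fun ρ => ρ) (by fun_prop) (by simp) r₁ hr₁).and
      ((hsmall (fun ρ => 3 * ρ) (by fun_prop) (by simp) r hr).and
      ((hsmall (fun ρ => c * (K * (3 * ρ))) (by fun_prop) (by simp) (1 / 2) (by norm_num)).and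
      ((hsmall (fun ρ => B * ρ) (by fun_prop) (by simp) 1 one_pos).and
      ((hsmall (fun ρ => ρ) (by fun_prop) (by simp) 1 one_pos).and
      self_mem_nhdsWithin))))).exists
  obtain ⟨U, hU, h0U, hUρ, hinv⟩ := h.exists_invariant_nhds ha hρ
  have hxρ : ∀ x ∈ U, ‖x‖ < ρ := fun x hx => mem_ball_zero_iff.1 (hUρ hx)
  have hUr₁ : ∀ x ∈ U, x ∈ ball (0 : E) r₁ := fun x hx => ball_subset_ball hρr₁.le (hUρ hx)
  have hpx : ∀ x ∈ U, ‖p x‖ ≤ ‖x‖ := fun x hx => by simpa using (hnear x (hUr₁ x hx)).2.1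
  have hRx : ∀ x ∈ U, ‖conjugacyDefect A f p x‖ ≤ M * ‖x‖ ^ N := fun x hx => by
    simpa using (hnear x (hUr₁ x hx)).2.2.2
  set ℓ : ℝ := K * (3 * ρ)
  have hℓ : 0 < ℓ := by positivity
  have hbase : ∀ x ∈ U, x + p x ∈ closedBall (0 : E) (3 * ρ) := fun x hx => by
    rw [mem_closedBall_zero_iff]
    have := norm_add_le x (p x)
    linarith [hpx x hx, hxρ x hx]
  have hmem : ∀ g, HolomorphicOfOrder U B N g → ∀ x ∈ U,
      x + p x + g x ∈ closedBall (0 : E) (3 * ρ) := by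
    intro g hg x hx
    have hxlt := hxρ x hx
    have h1 : B * ‖x‖ ^ N ≤ ρ := by
      have h2 : ‖x‖ ^ N ≤ ρ ^ 2 := (pow_le_pow_left₀ (norm_nonneg x) hxlt.le N).trans
        (pow_le_pow_of_le_one hρ.le hρ1.le hN)
      have h3 : B * ‖x‖ ^ N ≤ B * ρ ^ 2 := by gcongr
      nlinarith
    have h4 := norm_add₃_le (a := x) (b := p x) (c := g x)
    rw [mem_closedBall_zero_iff]
    linarith [hpx x hx, hg.norm_le x hx]
  let S : (E → E) → E → E := fun g x =>
    conjugacyDefect A f p x + (f (x + p x + g x) - f (x + p x))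
  have hSd : ∀ g, HolomorphicOfOrder U B N g → DifferentiableOn ℂ (S g) U := by
    intro g hg x hx
    have hsub : closedBall (0 : E) (3 * ρ) ⊆ ball 0 r := closedBall_subset_ball hρr
    have hfd' : ∀ y ∈ closedBall (0 : E) (3 * ρ), DifferentiableAt ℂ f y := fun y hy =>
      hfd.differentiableAt (isOpen_ball.mem_nhds (hsub hy))
    have hpd := (hnear x (hUr₁ x hx)).1
    have hgd := hg.differentiableOn.differentiableAt (hU.mem_nhds hx)
    refine DifferentiableAt.differentiableWithinAt ?_
    exact (hnear x (hUr₁ x hx)).2.2.1.add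
      (((hfd' _ (hmem g hg x hx)).comp x ((differentiableAt_id.add hpd).add hgd)).sub
      ((hfd' _ (hbase x hx)).comp x (differentiableAt_id.add hpd)))
  have hSM : ∀ g, HolomorphicOfOrder U B N g → ∀ x ∈ U, ‖S g x‖ ≤ (M + ℓ * B) * ‖x‖ ^ N := by
    intro g hg x hx
    refine (norm_add_le _ _).trans ?_
    have h1 := hlip _ hρr _ (hmem g hg x hx) _ (hbase x hx)
    rw [add_sub_cancel_left] at h1
    have h2 := mul_le_mul_of_nonneg_left (hg.norm_le x hx) hℓ.le
    linarith [hRx x hx]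
  have hSsub : ∀ g₁ g₂, HolomorphicOfOrder U B N g₁ → HolomorphicOfOrder U B N g₂ → ∀ x ∈ U,
      ‖S g₁ x - S g₂ x‖ ≤ ℓ * ‖g₁ x - g₂ x‖ := by
    intro g₁ g₂ hg₁ hg₂ x hx
    have h1 := hlip _ hρr _ (hmem g₁ hg₁ x hx) _ (hmem g₂ hg₂ x hx)
    rw [add_sub_add_left_eq_sub] at h1
    rwa [add_sub_add_left_eq_sub, sub_sub_sub_cancel_right]
  have hMB : 0 ≤ M + ℓ * B := by positivity
  have hT : ∀ g, HolomorphicOfOrder U B N g →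
      HolomorphicOfOrder U B N (homologicalSolution A (S g)) := by
    refine fun g hg => ⟨fun x hx => ?_, fun x hx => ?_⟩
    · obtain ⟨L, hL, -⟩ :=
        h.exists_hasFDerivAt_homologicalSolution hMB hU hinv (hSd g hg) (hSM g hg) hx
      exact hL.differentiableAt.differentiableWithinAt
    · refine (h.norm_homologicalSolution_le hMB hinv (hSM g hg) hx).trans ?_
      have : c * (M + ℓ * B) ≤ B := by
        have h1 : c * ℓ * B ≤ 1 / 2 * B := by gcongr
        have h2 : c * M = B / 2 := by simp only [B]; ring
        linarith
      gcongr
  obtain ⟨g, hg, hfix⟩ := exists_holomorphicOfOrder_fixedPoint hU hUρ hB.le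
    (fun g => homologicalSolution A (S g)) hT fun g₁ g₂ hg₁ hg₂ δ hδ hdist x hx => by
      rw [h.homologicalSolution_sub hMB hinv (hSd g₁ hg₁).continuousOn (hSM g₁ hg₁)
        (hSd g₂ hg₂).continuousOn (hSM g₂ hg₂) hx]
      refine (h.norm_homologicalSolution_le (M := ℓ * δ) (by positivity) hinv
        (fun y hy => ?_) hx).trans ?_
      · refine (hSsub g₁ g₂ hg₁ hg₂ y hy).trans ?_
        exact (mul_le_mul_of_nonneg_left (hdist y hy) hℓ.le).trans_eq (mul_assoc ..).symm
      · have h1 : c * ℓ * δ ≤ 1 / 2 * δ := by gcongr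
        have h2 : c * (ℓ * δ) ≤ δ / 2 := by linarith
        gcongr
  have hUnhds := hU.mem_nhds h0U
  refine ⟨fun x => p x + g x, ?_, hp2.add (IsBigO.of_bound B ?_), ?_⟩
  · filter_upwards [hUnhds] with x hx
    exact (hnear x (hUr₁ x hx)).1.add (hg.differentiableOn.differentiableAt (hU.mem_nhds hx))
  · filter_upwards [hUnhds] with x hx
    refine (hg.norm_le x hx).trans ?_
    rw [norm_pow, norm_norm]
    exact mul_le_mul_of_nonneg_left
      (pow_le_pow_of_le_one (norm_nonneg x) ((hxρ x hx).trans hρ1).le hN) hB.le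
  · filter_upwards [hUnhds] with x hx
    obtain ⟨L, hL, hLA⟩ :=
      h.exists_hasFDerivAt_homologicalSolution hMB hU hinv (hSd g hg) (hSM g hg) hx
    have hgL : HasFDerivAt g L x := hL.congr_of_eventuallyEq <| by
      filter_upwards [hU.mem_nhds hx] with y hy using (hfix y hy).symm
    rw [hfix x hx] at hLA
    rw [conjugacyDefect, ((hnear x (hUr₁ x hx)).1.hasFDerivAt.fun_add hgL).fderiv, _root_.add_apply,
      hLA, map_add]
    simp only [S, conjugacyDefect, ← add_assoc]
    abel

end Picard

section Linearization

open Metric Topology Module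

variable {E : Type} [NormedAddCommGroup E] [NormedSpace ℂ E]

theorem HolomorphicNearZero.isBigO_sub_fderiv {F : E → E} (hF : HolomorphicNearZero F)
    (hF0 : F 0 = 0) : (fun x => F x - fderiv ℂ F 0 x) =O[𝓝 0] fun x => ‖x‖ ^ 2 := by
  have hbound : ∀ᶠ x in 𝓝 0, ‖F x‖ < 1 :=
    hF.self_of_nhds.continuousAt.norm.eventually (gt_mem_nhds (by simp [hF0]))
  obtain ⟨r, hr, h⟩ := Metric.eventually_nhds_iff_ball.1 (Filter.Eventually.and hF hbound)
  refine IsBigO.of_bound (4 / r ^ 2) ?_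
  filter_upwards [ball_mem_nhds (0 : E) hr] with x hx
  have h1 := norm_sub_sub_fderiv_le (M := 1)
    (fun z hz => (h z hz).1.differentiableWithinAt) (fun z hz => (h z hz).2.le) hx
  simp only [hF0, sub_zero, mul_one, div_pow] at h1
  refine h1.trans_eq ?_
  rw [norm_pow, norm_norm]
  ring

variable [FiniteDimensional ℂ E]

theorem exists_flowBounds {A : E →L[ℂ] E} {a : ℝ} (ha : 0 < a)
    (hA : ∀ μ, End.HasEigenvalue (A : E →ₗ[ℂ] E) μ → μ.re < -a) :
    ∃ b C D N, FlowBounds A a b C D N ∧ 2 ≤ N := by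
  obtain ⟨C, hC, hCle⟩ := exists_norm_exp_smul_le A (-a) hA
  obtain ⟨D, hD, b, hDle⟩ := exists_norm_exp_neg_smul_le A
  obtain ⟨N, hN⟩ := exists_nat_gt (b / a)
  refine ⟨b, C, D, N + 2, ⟨hC, hD, fun t ht => ?_, fun t ht => ?_, ?_⟩, by omega⟩
  · rw [linearFlow, Complex.coe_smul]
    exact hCle t ht
  · rw [linearFlow, ← Complex.ofReal_neg, Complex.coe_smul]
    exact hDle t ht
  · rw [div_lt_iff₀ ha] at hN
    push_cast
    linarith

/-- Linearization of a holomorphic vector field whose linear part becomes contracting after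
multiplication with a complex scalar. -/
theorem HolomorphicNearZero.exists_linearization {F : E → E} {A : E →L[ℂ] E}
    (hF : HolomorphicNearZero F) (hF0 : F 0 = 0) (hFA : fderiv ℂ F 0 = A) {c : ℂ} (hc : c ≠ 0)
    {a : ℝ} (ha : 0 < a)
    (hre : ∀ μ, End.HasEigenvalue (A : E →ₗ[ℂ] E) μ → (c * μ).re < -a)
    (hnonres : ∀ k, 2 ≤ k → ∀ (μ : Fin k → ℂ) (ν : ℂ),
      (∀ i, End.HasEigenvalue (A : E →ₗ[ℂ] E) (μ i)) →
      End.HasEigenvalue (A : E →ₗ[ℂ] E) ν → ∑ i, μ i ≠ ν) :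
    ∃ w : E → E, HolomorphicNearZero w ∧ (w =O[𝓝 0] fun x => ‖x‖ ^ 2) ∧
      ∀ᶠ x in 𝓝 0, F (x + w x) = A x + fderiv ℂ w x (A x) := by
  have heig : ∀ μ, End.HasEigenvalue ((c • A : E →L[ℂ] E) : E →ₗ[ℂ] E) μ →
      End.HasEigenvalue (A : E →ₗ[ℂ] E) (c⁻¹ * μ) := by
    intro μ hμ
    obtain ⟨v, hv⟩ := hμ.exists_hasEigenvector
    refine End.hasEigenvalue_of_hasEigenvector (x := v) ⟨End.mem_eigenspace_iff.2 ?_, hv.2⟩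
    have h1 : c • A v = μ • v := hv.apply_eq_smul
    rw [mul_smul, ← h1, inv_smul_smul₀ hc]
    rfl
  obtain ⟨b, C, D, N, hflow, hN⟩ := exists_flowBounds (A := c • A) ha fun μ hμ => by
    simpa [mul_inv_cancel_left₀ hc] using hre _ (heig μ hμ)
  let f : E → E := fun x => c • (F x - A x)
  have hf : HolomorphicNearZero f := by
    filter_upwards [hF] with x hx
    exact (hx.sub A.differentiableAt).const_smul c
  have hf2 : f =O[𝓝 0] fun x => ‖x‖ ^ 2 := by
    have h1 := (hF.isBigO_sub_fderiv hF0).const_smul_left c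
    rwa [hFA] at h1
  obtain ⟨p, hp, hp2, hR⟩ := exists_conjugacyDefect_isBigO (A := c • A)
    (fun k hk μ ν hμ hν h => hnonres k hk _ _ (fun i => heig _ (hμ i)) (heig ν hν)
      (by rw [← Finset.mul_sum, h])) hf hf2 hN
  obtain ⟨w, hw, hw2, hwA⟩ := hflow.exists_conjugacyDefect_eq_zero ha hN hf hf2 hp hp2 hR
  refine ⟨w, hw, hw2, ?_⟩
  filter_upwards [hwA] with x hx
  simp only [_root_.conjugacyDefect, f, _root_.smul_apply, map_smul, ← smul_sub] at hx
  have h1 := (smul_eq_zero.1 hx).resolve_left hc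
  rw [map_add] at h1
  rw [← sub_eq_zero, ← h1]
  abel

/-- The holomorphic inverse function theorem near a fixed point, for maps tangent to the
identity, on a neighborhood where a prescribed local property holds. -/
theorem HolomorphicNearZero.exists_biholomorphic {h : E → E} (hh : HolomorphicNearZero h)
    (h0 : h 0 = 0) (hd : fderiv ℂ h 0 = ContinuousLinearMap.id ℂ E) {P : E → Prop}
    (hP : ∀ᶠ x in 𝓝 0, P x) :
    ∃ (U V : Set E) (hinv : E → E), IsOpen U ∧ IsOpen V ∧ 0 ∈ U ∧ 0 ∈ V ∧
      DifferentiableOn ℂ h U ∧ DifferentiableOn ℂ hinv V ∧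
      Set.MapsTo h U V ∧ Set.MapsTo hinv V U ∧
      (∀ x ∈ U, hinv (h x) = x) ∧ (∀ z ∈ V, h (hinv z) = z) ∧ ∀ x ∈ U, P x := by
  have : CompleteSpace E := FiniteDimensional.complete ℂ E
  have hcont : ContinuousAt (fderiv ℂ h) 0 := hh.fderiv.self_of_nhds.continuousAt
  have hstrict : HasStrictFDerivAt h
      ((ContinuousLinearEquiv.refl ℂ E : E ≃L[ℂ] E) : E →L[ℂ] E) 0 := by
    have h1 := hasStrictFDerivAt_of_hasFDerivAt_of_continuousAt
      (Filter.Eventually.mono hh fun x hx => hx.hasFDerivAt) hcont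
    rwa [hd] at h1
  have hequiv : ∀ᶠ x in 𝓝 0, ∃ e : E ≃L[ℂ] E, (e : E →L[ℂ] E) = fderiv ℂ h x := by
    have h1 := (ContinuousLinearEquiv.refl ℂ E).nhds
    rw [ContinuousLinearEquiv.coe_refl, ← hd] at h1
    exact hcont h1
  obtain ⟨W, hW, hWo, h0W⟩ := _root_.eventually_nhds_iff.1
    (Filter.Eventually.and hh (hequiv.and hP))
  let e := hstrict.toOpenPartialHomeomorph h
  have he : ∀ x, e x = h x := fun _ => rfl
  have h0e : (0 : E) ∈ e.source := hstrict.mem_toOpenPartialHomeomorph_source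
  have he0 : e.symm 0 = 0 := by
    have h1 := e.left_inv h0e
    rwa [he, h0] at h1
  refine ⟨e.source ∩ W, e.target ∩ e.symm ⁻¹' W, e.symm, e.open_source.inter hWo,
    e.isOpen_inter_preimage_symm hWo, ⟨h0e, h0W⟩, ⟨?_, ?_⟩,
    fun x hx => (hW x hx.2).1.differentiableWithinAt, fun z hz => ?_,
    fun x hx => ⟨e.map_source hx.1, ?_⟩, fun z hz => ⟨e.map_target hz.1, hz.2⟩,
    fun x hx => e.left_inv hx.1, fun z hz => e.right_inv hz.1, fun x hx => (hW x hx.2).2.2⟩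
  · have h1 := e.map_source h0e
    rwa [he, h0] at h1
  · rwa [Set.mem_preimage, he0]
  · obtain ⟨hdz, ⟨L, hL⟩, -⟩ := hW _ hz.2
    exact (e.hasFDerivAt_symm hz.1
      (hL ▸ hdz.hasFDerivAt)).differentiableAt.differentiableWithinAt
  · rw [Set.mem_preimage, ← he, e.left_inv hx.1]
    exact hx.2

end Linearization

/-- A finite set of complex numbers whose convex hull misses the origin can be rotated into a
left half-plane. -/
theorem exists_re_mul_lt_of_zero_notMem_convexHull {ι : Type*} [Finite ι] {lam : ι → ℂ}
    (h : (0 : ℂ) ∉ convexHull ℝ (Set.range lam)) :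
    ∃ c : ℂ, ∃ a > 0, ∀ j, (c * lam j).re < -a := by
  obtain ⟨φ, a, ha, hφ⟩ := geometric_hahn_banach_point_closed (convex_convexHull ℝ _)
    ((Set.finite_range lam).isClosed_convexHull ℝ) h
  rw [map_zero] at ha
  refine ⟨⟨-φ 1, φ Complex.I⟩, a, ha, fun j => ?_⟩
  have h1 := hφ _ (subset_convexHull ℝ _ (Set.mem_range_self j))
  have h2 : lam j = (lam j).re • (1 : ℂ) + (lam j).im • Complex.I := by
    simp [Complex.re_add_im]
  rw [h2, map_add, map_smul, map_smul, smul_eq_mul, smul_eq_mul] at h1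
  rw [Complex.mul_re]
  linarith

theorem sum_comp_eq_sum_card_mul {ι κ : Type*} [Fintype ι] [Fintype κ] [DecidableEq κ]
    (lam : κ → ℂ) (σ : ι → κ) :
    ∑ i, lam (σ i) = ∑ j, ((Finset.univ.filter fun i => σ i = j).card : ℂ) * lam j := by
  rw [← Finset.sum_fiberwise Finset.univ σ]
  refine Finset.sum_congr rfl fun j _ => ?_
  rw [Finset.sum_congr rfl fun i hi => by rw [(Finset.mem_filter.1 hi).2], Finset.sum_const,
    nsmul_eq_mul]

/-- **Poincaré's linearization theorem.** Let `F` be holomorphic near `0 ∈ ℂⁿ` with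
`F 0 = 0`, let `A = F'(0)` and let `λ₁, …, λₙ` be the eigenvalues of `A` with multiplicity
(the roots of the characteristic polynomial of its matrix in the standard basis). If the
eigenvalues lie in the Poincaré domain (`0` is not in their convex hull) and there is no
resonance (`λ_j ≠ i₁λ₁ + ⋯ + iₙλₙ` whenever `i₁ + ⋯ + iₙ ≥ 2`), then the system `ż = F z`
is linearizable at `0`: there is a biholomorphic map `h` between neighborhoods of `0` with
`h 0 = 0` and `F (h x) = h'(x) (A x)` for all `x` in its domain. -/
theorem poincare_linearization (n : ℕ) (hn : 0 < n)
    (F : EuclideanSpace ℂ (Fin n) → EuclideanSpace ℂ (Fin n))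
    (U₀ : Set (EuclideanSpace ℂ (Fin n))) (hU₀ : IsOpen U₀) (h0U₀ : 0 ∈ U₀)
    (hF : DifferentiableOn ℂ F U₀) (hF0 : F 0 = 0)
    (lam : Fin n → ℂ)
    (heig : (LinearMap.toMatrix (EuclideanSpace.basisFun (Fin n) ℂ).toBasis
        (EuclideanSpace.basisFun (Fin n) ℂ).toBasis
        (fderiv ℂ F 0 : EuclideanSpace ℂ (Fin n) →ₗ[ℂ] EuclideanSpace ℂ (Fin n))).charpoly
      = ∏ j : Fin n, (X - C (lam j)))
    (hpoincare : (0 : ℂ) ∉ convexHull ℝ (Set.range lam))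
    (hnonres : ∀ idx : Fin n → ℕ, 2 ≤ ∑ k, idx k → ∀ j : Fin n,
      lam j ≠ ∑ k, (idx k : ℂ) * lam k) :
    ∃ (U V : Set (EuclideanSpace ℂ (Fin n)))
      (h hinv : EuclideanSpace ℂ (Fin n) → EuclideanSpace ℂ (Fin n)),
      IsOpen U ∧ IsOpen V ∧ (0 : EuclideanSpace ℂ (Fin n)) ∈ U ∧
      (0 : EuclideanSpace ℂ (Fin n)) ∈ V ∧ V ⊆ U₀ ∧
      DifferentiableOn ℂ h U ∧ DifferentiableOn ℂ hinv V ∧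
      Set.MapsTo h U V ∧ Set.MapsTo hinv V U ∧
      (∀ x ∈ U, hinv (h x) = x) ∧ (∀ z ∈ V, h (hinv z) = z) ∧
      h 0 = 0 ∧
      ∀ x ∈ U, F (h x) = (fderiv ℂ h x) ((fderiv ℂ F 0) x) := by
  set A := fderiv ℂ F 0 with hA
  have hspec : ∀ μ, Module.End.HasEigenvalue
      (A : EuclideanSpace ℂ (Fin n) →ₗ[ℂ] EuclideanSpace ℂ (Fin n)) μ → ∃ j, lam j = μ := by
    intro μ hμ
    rw [Module.End.hasEigenvalue_iff_isRoot_charpoly, ← LinearMap.charpoly_toMatrix _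
      (EuclideanSpace.basisFun (Fin n) ℂ).toBasis, heig, IsRoot.def, eval_prod,
      Finset.prod_eq_zero_iff] at hμ
    obtain ⟨j, -, hj⟩ := hμ
    exact ⟨j, by simpa [sub_eq_zero, eq_comm] using hj⟩
  obtain ⟨c, a, ha, hc⟩ := exists_re_mul_lt_of_zero_notMem_convexHull hpoincare
  have hc0 : c ≠ 0 := by
    rintro rfl
    have := hc ⟨0, hn⟩
    simp at this
    linarith
  have hFz : HolomorphicNearZero F := by
    filter_upwards [hU₀.mem_nhds h0U₀] with x hx using hF.differentiableAt (hU₀.mem_nhds hx)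
  obtain ⟨w, hw, hw2, hwA⟩ := hFz.exists_linearization hF0 hA.symm hc0 ha
    (fun μ hμ => by
      obtain ⟨j, rfl⟩ := hspec μ hμ
      exact hc j)
    (fun k hk μ ν hμ hν hsum => by
      choose σ hσ using fun i => hspec (μ i) (hμ i)
      obtain ⟨j, rfl⟩ := hspec ν hν
      refine hnonres (fun j => (Finset.univ.filter fun i => σ i = j).card) ?_ j ?_
      · rw [← Finset.card_eq_sum_card_fiberwise (fun i _ => Finset.mem_coe.2 (Finset.mem_univ _))]
        simpa using hk
      · rw [← sum_comp_eq_sum_card_mul, ← hsum]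
        simp [hσ])
  have hw' : HasFDerivAt w
      (0 : EuclideanSpace ℂ (Fin n) →L[ℂ] EuclideanSpace ℂ (Fin n)) 0 :=
    IsBigO.hasFDerivAt (by simpa using hw2) one_lt_two
  have hw0 : w 0 = 0 := by
    obtain ⟨K, hK⟩ := hw2.bound
    simpa using hK.self_of_nhds
  have hh : HolomorphicNearZero fun x => x + w x := by
    filter_upwards [hw] with x hx using differentiableAt_id.add hx
  have hmem : ∀ᶠ x in nhds 0, x + w x ∈ U₀ :=
    (hh.self_of_nhds.continuousAt).eventually (by simpa [hw0] using hU₀.mem_nhds h0U₀)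
  obtain ⟨U, V, hinv, hUo, hVo, h0U, h0V, hdU, hdV, hUV, hVU, hl, hr, hP⟩ :=
    hh.exists_biholomorphic (by simp [hw0])
      (by simpa using ((hasFDerivAt_id _).fun_add hw').fderiv)
      (hmem.and (Filter.Eventually.and hw hwA))
  refine ⟨U, V, _, hinv, hUo, hVo, h0U, h0V, fun z hz => ?_, hdU, hdV, hUV, hVU, hl, hr,
    by simp [hw0], fun x hx => ?_⟩
  · rw [← hr z hz]
    exact (hP _ (hVU hz)).1
  · obtain ⟨-, hwx, hx⟩ := hP x hx
    have hd : HasFDerivAt (fun x => x + w x) (ContinuousLinearMap.id ℂ _ + fderiv ℂ w x) x :=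
      (hasFDerivAt_id x).fun_add hwx.hasFDerivAt
    rw [hx, hd.fderiv]
    rfl
end
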